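/- arXiv:0904.1540 — 5 statements merged into one kernel-verified Lean document; each statement's English description precedes it below -/
import Mathlib

section
/- Let (R, m) be a one-dimensional Noetherian complete local domain whose residue field R/m has prime characteristic p. Then R^+ is quasi-local with a unique maximal ideal m_{R^+}, and gldim(R^+) = pd_{R^+}(R^+/m_{R^+}) = 2. -/
set_option synthInstance.maxHeartbeats 400000
set_option maxHeartbeats 1000000

universe u

open CategoryTheory CategoryTheory.Limits

/-- `hasPdLE A n M` : the `A`-module `M` admits a projective resolution of length
at most `n`, i.e. has projective dimension `≤ n`. -/
def hasPdLE (A : Type u) [CommRing A] : ℕ → ModuleCat.{u} A → Prop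
  | 0, M => Projective M
  | n + 1, M => ∃ (P : ModuleCat.{u} A) (f : P ⟶ M), Epi f ∧ Projective P ∧
      hasPdLE A n (kernel f)

/-- The projective dimension `pd_A(M)` of an `A`-module `M`, valued in `ℕ∞`
(`⊤` if no finite projective resolution exists). -/
noncomputable def projDim (A : Type u) [CommRing A] (M : Type u) [AddCommGroup M]
    [Module A M] : ℕ∞ :=
  sInf {n : ℕ∞ | ∃ k : ℕ, n = k ∧ hasPdLE A k (ModuleCat.of A M)}

/-- The global dimension of a commutative ring: the supremum of the projective
dimensions of all its modules. -/
noncomputable def gldim (A : Type u) [CommRing A] : ℕ∞ :=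
  ⨆ M : ModuleCat.{u} A, projDim A M

/-- Reinterpret an `ℕ∞`-valued homological dimension as an element of
`WithBot (WithTop ℕ)`, to compare it with Krull dimensions. -/
def toWB (n : ℕ∞) : WithBot (WithTop ℕ) := ((show WithTop ℕ from n) : WithBot (WithTop ℕ))

/-- The absolute integral closure `R⁺` of a domain `R`: the integral closure of `R`
inside an algebraic closure of its field of fractions. -/
abbrev RPlus (R : Type u) [CommRing R] [IsDomain R] : Type u :=
  ↥(integralClosure R (AlgebraicClosure (FractionRing R)))


section HomologicalPart

open CategoryTheory CategoryTheory.Limits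

theorem aux_hasPdLE_iff (A : Type u) [CommRing A] (n : ℕ) (M : ModuleCat.{u} A) :
    hasPdLE A n M ↔ HasProjectiveDimensionLT M (n + 1) := by
  induction n generalizing M with
  | zero =>
    simp only [hasPdLE]
    exact projective_iff_hasProjectiveDimensionLT_one
  | succ n ih =>
    simp only [hasPdLE]
    constructor
    · rintro ⟨P, f, hf, hP, hk⟩
      have h : (ShortComplex.mk _ _ (kernel.condition f)).ShortExact :=
        { exact := ShortComplex.exact_kernel f }
      exact (h.hasProjectiveDimensionLT_X₃_iff n hP).2 ((ih _).1 hk)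
    · intro hM
      obtain ⟨⟨P, f⟩⟩ := EnoughProjectives.presentation M
      have h : (ShortComplex.mk _ _ (kernel.condition f)).ShortExact :=
        { exact := ShortComplex.exact_kernel f }
      exact ⟨P, f, inferInstance, inferInstance,
        (ih _).2 ((h.hasProjectiveDimensionLT_X₃_iff n inferInstance).1 hM)⟩

theorem aux_ses_ideal (A : Type u) [CommRing A] (I : Ideal A) :
    ∃ S : ShortComplex (ModuleCat.{u} A), S.ShortExact ∧ S.X₁ = ModuleCat.of A I ∧
      S.X₂ = ModuleCat.of A A ∧ S.X₃ = ModuleCat.of A (A ⧸ I) := by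
  have hz : I.mkQ ∘ₗ I.subtype = 0 := (LinearMap.exact_subtype_mkQ I).linearMap_comp_eq_zero
  refine ⟨ModuleCat.shortComplexOfCompEqZero _ _ hz, ?_, rfl, rfl, rfl⟩
  refine ModuleCat.shortComplex_shortExact _ ?_ ?_ ?_
  · exact LinearMap.exact_subtype_mkQ I
  · exact I.injective_subtype
  · exact I.mkQ_surjective

theorem aux_inj_of_ext_one (A : Type u) [CommRing A] (N : ModuleCat.{u} A)
    (h : ∀ I : Ideal A, Subsingleton (Abelian.Ext (ModuleCat.of A (A ⧸ I)) N 1)) :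
    Injective N := by
  rw [← Module.injective_iff_injective_object]
  apply Module.Baer.injective
  intro I g
  have hz : I.mkQ ∘ₗ I.subtype = 0 := (LinearMap.exact_subtype_mkQ I).linearMap_comp_eq_zero
  let S : ShortComplex (ModuleCat.{u} A) := ModuleCat.shortComplexOfCompEqZero _ _ hz
  have hS : S.ShortExact := ModuleCat.shortComplex_shortExact S
    (LinearMap.exact_subtype_mkQ I) I.injective_subtype I.mkQ_surjective
  have : Subsingleton (Abelian.Ext S.X₃ N 1) := h I
  let gm : S.X₁ ⟶ N := ModuleCat.ofHom g
  obtain ⟨y, hy⟩ := Abelian.Ext.contravariant_sequence_exact₁ hS N (Abelian.Ext.mk₀ gm)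
    (n₁ := 1) rfl (Subsingleton.elim _ _)
  obtain ⟨y, rfl⟩ := (Abelian.Ext.mk₀_bijective _ _).2 y
  rw [Abelian.Ext.mk₀_comp_mk₀, (Abelian.Ext.mk₀_bijective _ _).1.eq_iff] at hy
  refine ⟨y.hom, fun x hx => ?_⟩
  exact congr($(hy).hom ⟨x, hx⟩)

theorem aux_injdim (A : Type u) [CommRing A] (n : ℕ) (N : ModuleCat.{u} A)
    (h : ∀ I : Ideal A, Subsingleton (Abelian.Ext (ModuleCat.of A (A ⧸ I)) N (n + 1))) :
    HasInjectiveDimensionLT N (n + 1) := by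
  induction n generalizing N with
  | zero =>
    rw [zero_add, ← injective_iff_hasInjectiveDimensionLT_one]
    exact aux_inj_of_ext_one A N h
  | succ n ih =>
    let ⟨E, hE, f, hf⟩ := EnoughInjectives.presentation N
    have hS : (ShortComplex.mk _ _ (cokernel.condition f)).ShortExact :=
      { exact := ShortComplex.exact_cokernel f }
    refine (hS.hasInjectiveDimensionLT_X₃_iff n hE).1 (ih _ fun I => ?_)
    refine subsingleton_of_forall_eq 0 fun x => ?_
    have := h I
    obtain ⟨y, rfl⟩ := Abelian.Ext.covariant_sequence_exact₃ _ hS x (n₁ := n + 1 + 1) rfl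
      (Subsingleton.elim _ _)
    rw [Abelian.Ext.eq_zero_of_injective y]
    simp

theorem aux_gldim (A : Type u) [CommRing A] (n : ℕ)
    (h : ∀ I : Ideal A, HasProjectiveDimensionLT (ModuleCat.of A (A ⧸ I)) (n + 1))
    (M : ModuleCat.{u} A) : HasProjectiveDimensionLT M (n + 1) := by
  refine hasProjectiveDimensionLT_of_enoughInjectives M (n + 1) fun Y => ?_
  have : HasInjectiveDimensionLT Y (n + 1) :=
    aux_injdim A n Y fun I => (h I).subsingleton _ _ _ le_rfl _
  exact HasInjectiveDimensionLT.subsingleton Y (n + 1) _ le_rfl _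

/-- chain resolution -/
theorem aux_chain (A : Type u) [CommRing A] [IsDomain A] (I : Ideal A) (a c : ℕ → A)
    (ha0 : ∀ n, a n ≠ 0) (hac : ∀ n, a n = c n * a (n + 1)) (haI : ∀ n, a n ∈ I)
    (hI : ∀ x ∈ I, ∃ n, a n ∣ x) : HasProjectiveDimensionLT (ModuleCat.of A I) 2 := by
  classical
  let g : (ℕ →₀ A) →ₗ[A] I := Finsupp.linearCombination A (fun n => (⟨a n, haI n⟩ : I))
  have hg : Function.Surjective g := by
    rintro ⟨x, hx⟩
    obtain ⟨n, b, rfl⟩ := hI x hx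
    refine ⟨Finsupp.single n b, ?_⟩
    simp [g, mul_comm]
  let f : (ℕ →₀ A) →ₗ[A] (ℕ →₀ A) := Finsupp.linearCombination A
    (fun n => Finsupp.single n 1 - Finsupp.single (n + 1) (c n))
  have hf0 : ∀ x, f x 0 = x 0 := by
    intro x
    induction x using Finsupp.induction_linear with
    | zero => simp
    | add x y hx hy => simp [hx, hy]
    | single n b => simp [f, Finsupp.single_apply]
  have hfs : ∀ x n, f x (n + 1) = x (n + 1) - c n * x n := by
    intro x n
    induction x using Finsupp.induction_linear with
    | zero => simp
    | add x y hx hy => simp [hx, hy]; ring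
    | single k b =>
      simp only [f, Finsupp.linearCombination_single, Finsupp.smul_apply, Finsupp.sub_apply,
        Finsupp.single_apply, smul_eq_mul, add_left_inj]
      split_ifs <;> first | omega | (subst_vars; ring)
  have hfinj : Function.Injective f := by
    rw [injective_iff_map_eq_zero]
    intro x hx
    ext n
    induction n with
    | zero => rw [← hf0, hx]
    | succ n ih =>
      have := hfs x n
      rw [hx, ih] at this
      simpa using this.symm
  have hgf : g ∘ₗ f = 0 := by
    refine Finsupp.lhom_ext fun n b => ?_
    apply Subtype.ext
    simp [f, g]
    right
    rw [← hac n]; simp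
  have hex : Function.Exact f g := by
    rw [LinearMap.exact_iff]
    refine le_antisymm ?_ ?_
    · intro y hy
      rw [LinearMap.mem_ker] at hy
      let x : ℕ → A := fun n => Nat.rec (y 0) (fun k z => y (k + 1) + c k * z) n
      have hx0 : x 0 = y 0 := rfl
      have hxs : ∀ n, x (n + 1) = y (n + 1) + c n * x n := fun n => rfl
      have hsum : ∀ n, x n * a n = ∑ i ∈ Finset.range (n + 1), y i * a i := by
        intro n
        induction n with
        | zero => simp [hx0]
        | succ n ih =>
          rw [Finset.sum_range_succ, ← ih, hxs, hac n]; ring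
      obtain ⟨N, hN⟩ : ∃ N, ∀ i ∈ y.support, i < N := by
        obtain ⟨N, hN⟩ := y.support.exists_nat_subset_range
        exact ⟨N, fun i hi => Finset.mem_range.1 (hN hi)⟩
      have hyz : ∀ n, N ≤ n → x n = 0 := by
        intro n hn
        have h1 : ∑ i ∈ Finset.range (n + 1), y i * a i = 0 := by
          have h2 : ((g y : I) : A) = 0 := by rw [hy]; rfl
          have h3 : ((g y : I) : A) = y.sum fun i b => b * a i := by
            simp [g, Finsupp.linearCombination_apply, Finsupp.sum]
          rw [h3, Finsupp.sum_of_support_subset y (s := Finset.range (n + 1))] at h2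
          · exact h2
          · intro i hi
            have := hN i hi
            simp; omega
          · simp
        have h4 := hsum n
        rw [h1] at h4
        exact (mul_eq_zero.1 h4).resolve_right (ha0 n)
      let X : ℕ →₀ A := Finsupp.onFinset (Finset.range N) x (by
        intro n hn
        by_contra hcon
        exact hn (hyz n (by simpa using hcon)))
      have hX : ∀ n, X n = x n := fun n => rfl
      refine ⟨X, ?_⟩
      ext n
      cases n with
      | zero => rw [hf0, hX, hx0]
      | succ n => rw [hfs, hX, hX, hxs]; ring
    · rintro _ ⟨x, rfl⟩
      exact LinearMap.congr_fun hgf x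
  let S : ShortComplex (ModuleCat.{u} A) := ModuleCat.shortComplexOfCompEqZero f g hgf
  let e : (ℕ →₀ A) ≃ₗ[A] (ULift.{u} ℕ →₀ A) := Finsupp.domLCongr Equiv.ulift.symm
  have hS : S.ShortExact := ModuleCat.shortComplex_shortExact S hex hfinj hg
  have hP : Projective (ModuleCat.of A (ℕ →₀ A)) :=
    (IsProjective.iff_projective (ℕ →₀ A)).1 inferInstance
  have h1 : Projective S.X₁ := hP
  exact (hS.hasProjectiveDimensionLT_X₃_iff 0 hP).2 inferInstance

/-- ideals in a valuation ring with a countable dense set -/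
theorem aux_ideal_pd (A : Type u) [CommRing A] [IsDomain A]
    (hv : ∀ a b : A, a ∣ b ∨ b ∣ a) (D : ℕ → A) (hD0 : ∀ n, D n ≠ 0)
    (hD : ∀ a c : A, a ≠ 0 → c ≠ 0 → ¬ IsUnit c → ∃ n, a ∣ D n ∧ D n ∣ a * c) (I : Ideal A) :
    HasProjectiveDimensionLT (ModuleCat.of A I) 2 := by
  classical
  by_cases hbot : I = ⊥
  · subst hbot
    have : Projective (ModuleCat.of A (⊥ : Ideal A)) :=
      (IsProjective.iff_projective (⊥ : Ideal A)).1 inferInstance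
    exact hasProjectiveDimensionLT_of_ge _ 1 2 (by norm_num)
  obtain ⟨x₀, hx₀, hx₀0⟩ := Submodule.exists_mem_ne_zero_of_ne_bot hbot
  by_cases hp : ∃ g ∈ I, ∀ x ∈ I, g ∣ x
  · obtain ⟨g, hgI, hg⟩ := hp
    have hg0 : g ≠ 0 := by
      rintro rfl
      exact hx₀0 (zero_dvd_iff.1 (hg x₀ hx₀))
    exact aux_chain A I (fun _ => g) (fun _ => 1) (fun _ => hg0) (by simp) (fun _ => hgI)
      (fun x hx => ⟨0, hg x hx⟩)
  push Not at hp
  let a : ℕ → A := fun n => Nat.rec (motive := fun _ => A) x₀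
    (fun k z => if D k ∈ I ∧ D k ∣ z then D k else z) n
  have has : ∀ n, a (n + 1) = if D n ∈ I ∧ D n ∣ a n then D n else a n := fun n => rfl
  have haI : ∀ n, a n ∈ I := by
    intro n
    induction n with
    | zero => exact hx₀
    | succ n ih => rw [has]; split_ifs with h; exacts [h.1, ih]
  have ha0 : ∀ n, a n ≠ 0 := by
    intro n
    induction n with
    | zero => exact hx₀0
    | succ n ih => rw [has]; split_ifs with h; exacts [hD0 n, ih]
  have hdvd : ∀ n, a (n + 1) ∣ a n := by
    intro n
    rw [has]; split_ifs with h; exacts [h.2, dvd_rfl]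
  have hdvd2 : ∀ n, D n ∈ I → a (n + 1) ∣ D n := by
    intro n hn
    rw [has]; split_ifs with h
    · exact dvd_rfl
    · exact (hv _ _).resolve_right fun h' => h ⟨hn, h'⟩
  choose c hc using hdvd
  refine aux_chain A I a c ha0 (fun n => by rw [mul_comm]; exact hc n) haI ?_
  intro x hx
  by_cases hx0 : x = 0
  · exact ⟨0, hx0 ▸ dvd_zero _⟩
  obtain ⟨y, hy, hxy⟩ := hp x hx
  obtain ⟨b, rfl⟩ := (hv x y).resolve_left hxy
  obtain ⟨n, h1, h2⟩ := hD y b (left_ne_zero_of_mul hx0) (right_ne_zero_of_mul hx0) (by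
    intro hb
    exact hxy ((hb.mul_right_dvd).2 dvd_rfl))
  exact ⟨n + 1, (hdvd2 n (I.mem_of_dvd h1 hy)).trans h2⟩

theorem aux_fg_of_projective (A : Type u) [CommRing A] [IsDomain A] (I : Ideal A)
    [Module.Projective A I] : I.FG := by
  classical
  by_cases hbot : I = ⊥
  · subst hbot; exact Submodule.fg_bot
  obtain ⟨x, hx, hx0⟩ := Submodule.exists_mem_ne_zero_of_ne_bot hbot
  obtain ⟨s, hs⟩ := Module.projective_def'.1 (inferInstance : Module.Projective A I)
  refine ⟨(s ⟨x, hx⟩).support.image (fun i : I => (i : A)), le_antisymm ?_ ?_⟩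
  · rw [Ideal.span_le]
    intro z hz
    simp only [Finset.coe_image, Set.mem_image] at hz
    obtain ⟨i, -, rfl⟩ := hz
    exact i.2
  · intro y hy
    have h1 : x • s ⟨y, hy⟩ = y • s ⟨x, hx⟩ := by
      rw [← map_smul, ← map_smul]
      congr 1
      ext; simp [mul_comm]
    have h2 : y = (s ⟨y, hy⟩).sum fun i b => b * (i : A) := by
      have := congrArg Subtype.val (LinearMap.congr_fun hs ⟨y, hy⟩)
      simp [Finsupp.linearCombination_apply, Finsupp.sum] at this
      rw [Finsupp.sum]; exact this.symm
    rw [h2]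
    refine Ideal.sum_mem _ fun i hi => Ideal.mul_mem_left _ _ (Ideal.subset_span ?_)
    simp only [Finset.coe_image, Set.mem_image]
    refine ⟨i, ?_, rfl⟩
    simp only [Finset.mem_coe, Finsupp.mem_support_iff] at hi ⊢
    intro h3
    have h4 := DFunLike.congr_fun h1 i
    simp [h3] at h4
    rcases h4 with h4 | h4
    exacts [hx0 h4, hi h4]

theorem aux_main (A : Type u) [CommRing A] [IsDomain A] [IsLocalRing A]
    (hv : ∀ a b : A, a ∣ b ∨ b ∣ a) (D : ℕ → A) (hD0 : ∀ n, D n ≠ 0)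
    (hD : ∀ a c : A, a ≠ 0 → c ≠ 0 → ¬ IsUnit c → ∃ n, a ∣ D n ∧ D n ∣ a * c)
    (hsq : ∀ a : A, ∃ b, b ^ 2 = a) (hm : IsLocalRing.maximalIdeal A ≠ ⊥) :
    gldim A = 2 ∧ projDim A (A ⧸ IsLocalRing.maximalIdeal A) = 2 := by
  have hAproj : Projective (ModuleCat.of A A) := (IsProjective.iff_projective A).1 inferInstance
  have hall : ∀ M : ModuleCat.{u} A, HasProjectiveDimensionLT M 3 := by
    refine aux_gldim A 2 fun I => ?_
    obtain ⟨S, hS, h1, h2, h3⟩ := aux_ses_ideal A I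
    rw [← h3, hS.hasProjectiveDimensionLT_X₃_iff 1 (h2 ▸ hAproj), h1]
    exact aux_ideal_pd A hv D hD0 hD I
  have hle : ∀ M : ModuleCat.{u} A, projDim A M ≤ 2 := by
    intro M
    exact sInf_le ⟨2, rfl, (aux_hasPdLE_iff A 2 _).2 (hall _)⟩
  have hge : 2 ≤ projDim A (A ⧸ IsLocalRing.maximalIdeal A) := by
    refine le_sInf ?_
    rintro _ ⟨k, rfl, hk⟩
    by_contra hlt
    have hk1 : k + 1 ≤ 2 := by
      have : (k : ℕ∞) < (2 : ℕ) := not_le.1 hlt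
      have := Nat.cast_lt.1 this
      omega
    have hk' := (aux_hasPdLE_iff A k _).1 hk
    have hk2 := hasProjectiveDimensionLT_of_ge (ModuleCat.of A (A ⧸ IsLocalRing.maximalIdeal A))
      (k + 1) 2 hk1
    obtain ⟨S, hS, h1, h2, h3⟩ := aux_ses_ideal A (IsLocalRing.maximalIdeal A)
    rw [← h3, hS.hasProjectiveDimensionLT_X₃_iff 0 (h2 ▸ hAproj), h1] at hk2
    have hpm : Module.Projective A (IsLocalRing.maximalIdeal A) :=
      (IsProjective.iff_projective (IsLocalRing.maximalIdeal A)).2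
        (projective_iff_hasProjectiveDimensionLT_one.2 hk2)
    have hfg := aux_fg_of_projective A (IsLocalRing.maximalIdeal A)
    have hidem : IsLocalRing.maximalIdeal A ≤
        IsLocalRing.maximalIdeal A • IsLocalRing.maximalIdeal A := by
      intro x hx
      obtain ⟨y, rfl⟩ := hsq x
      have hy := Ideal.IsPrime.mem_of_pow_mem inferInstance 2 hx
      rw [pow_two]
      exact Ideal.mul_mem_mul hy hy
    exact hm (Submodule.eq_bot_of_le_smul_of_le_jacobson_bot _ _ hfg hidem
      (IsLocalRing.maximalIdeal_le_jacobson _))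
  refine ⟨le_antisymm (iSup_le hle) ?_, le_antisymm (hle (ModuleCat.of A _)) hge⟩
  exact hge.trans (le_iSup (fun M : ModuleCat.{u} A => projDim A M)
    (ModuleCat.of A (A ⧸ IsLocalRing.maximalIdeal A)))

end HomologicalPart

section RingPart

open Polynomial

theorem aux_local (R A : Type u) [CommRing R] [IsLocalRing R]
    [IsAdicComplete (IsLocalRing.maximalIdeal R) R] [CommRing A] [IsDomain A] [Algebra R A]
    [Algebra.IsIntegral R A] : IsLocalRing A := by
  refine IsLocalRing.of_isUnit_or_isUnit_one_sub_self fun e => ?_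
  by_contra! hcon
  obtain ⟨h1, h2⟩ := hcon
  obtain ⟨M₁, hM₁, he1⟩ := exists_max_ideal_of_mem_nonunits h1
  obtain ⟨M₂, hM₂, he2⟩ := exists_max_ideal_of_mem_nonunits h2
  obtain ⟨f, hf, hfe⟩ := Algebra.IsIntegral.isIntegral (R := R) e
  have hne : (f : PowerSeries R).map (IsLocalRing.residue R) ≠ 0 := by
    intro h
    have := congrArg (PowerSeries.coeff f.natDegree) h
    simp [hf.coeff_natDegree] at this
  obtain ⟨P, U, hPU⟩ := PowerSeries.exists_isWeierstrassFactorization (g := (f : PowerSeries R)) hne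
  have hPd := hPU.isDistinguishedAt
  have hdiv : f = P * (f /ₘ P) + f %ₘ P := by rw [add_comm]; exact (modByMonic_add_div f P).symm
  have hPne : (P : PowerSeries R).map (IsLocalRing.residue R) ≠ 0 := by
    intro h
    have := congrArg (PowerSeries.coeff P.natDegree) h
    simp [hPd.monic.coeff_natDegree] at this
  have hord : (((P : PowerSeries R).map
      (Ideal.Quotient.mk (IsLocalRing.maximalIdeal R))).order).toNat = P.natDegree := by
    rw [← hPd.coe_natDegree_eq_order_map (P : PowerSeries R) 1 (by simp) (by simp)]
    simp
  have w1 : (f : PowerSeries R).IsWeierstrassDivision (P : PowerSeries R) U 0 :=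
    ⟨by simp, by simpa using hPU.eq_mul⟩
  have w2 : (f : PowerSeries R).IsWeierstrassDivision (P : PowerSeries R)
      ((f /ₘ P : R[X]) : PowerSeries R) (f %ₘ P) := by
    refine ⟨?_, ?_⟩
    · rw [hord, ← degree_eq_natDegree hPd.monic.ne_zero]
      exact degree_modByMonic_lt f hPd.monic
    · rw [← coe_mul, ← coe_add, ← hdiv]
  obtain ⟨hq, hr⟩ := w1.elim hPne w2
  set q := f /ₘ P with hqdef
  rw [← hr, add_zero] at hdiv
  have hq0 : IsUnit (q.coeff 0) := by
    have := hPU.isUnit.map (PowerSeries.constantCoeff (R := R))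
    rw [hq] at this
    simpa using this
  have hev : aeval e P * aeval e q = 0 := by
    rw [← map_mul, ← hdiv]; exact hfe
  rcases mul_eq_zero.1 hev with h | h
  · -- work modulo `M₂`
    have hcomap : M₂.comap (algebraMap R A) = IsLocalRing.maximalIdeal R :=
      IsLocalRing.eq_maximalIdeal (Ideal.isMaximal_comap_of_isIntegral_of_isMaximal M₂)
    have key : P.map ((Ideal.Quotient.mk M₂).comp (algebraMap R A)) = X ^ P.natDegree := by
      ext i
      simp only [coeff_map, coeff_X_pow, RingHom.comp_apply]
      split_ifs with hi
      · subst hi; simp [hPd.monic.coeff_natDegree]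
      · rw [Ideal.Quotient.eq_zero_iff_mem, ← Ideal.mem_comap, hcomap]
        rcases lt_or_gt_of_ne hi with hlt | hgt
        · exact hPd.mem hlt
        · rw [coeff_eq_zero_of_natDegree_lt hgt]; exact zero_mem _
    have h3 := congrArg (Ideal.Quotient.mk M₂) h
    rw [aeval_def, hom_eval₂, ← Polynomial.eval_map, key, map_zero] at h3
    have h4 : Ideal.Quotient.mk M₂ e = 1 := by
      have : Ideal.Quotient.mk M₂ (1 - e) = 0 := Ideal.Quotient.eq_zero_iff_mem.2 he2
      rw [map_sub, map_one, sub_eq_zero] at this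
      exact this.symm
    rw [h4] at h3
    simp at h3
  · have h3 := congrArg (Ideal.Quotient.mk M₁) h
    rw [aeval_def, hom_eval₂, Ideal.Quotient.eq_zero_iff_mem.2 he1, eval₂_at_zero, map_zero] at h3
    exact (hq0.map ((Ideal.Quotient.mk M₁).comp (algebraMap R A))).ne_zero h3

theorem aux_poly (R K : Type u) [CommRing R] [IsDomain R] [IsNoetherianRing R] [IsLocalRing R]
    (hdim : ringKrullDim R = 1) (hm : IsLocalRing.maximalIdeal R ≠ ⊥) [Field K] [Algebra R K]
    [FaithfulSMul R K] (x : K) (hx : IsAlgebraic R x) :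
    ∃ f : R[X], aeval x f = 0 ∧ ∃ i, IsUnit (f.coeff i) := by
  by_contra! hcon
  set m := IsLocalRing.maximalIdeal R with hmdef
  let I : Ideal R[X] := RingHom.ker (aeval (R := R) x)
  have hIprime : I.IsPrime := RingHom.ker_isPrime _
  have hI0 : (⊥ : Ideal R[X]) < I := by
    rw [bot_lt_iff_ne_bot]
    obtain ⟨f, hf0, hf⟩ := hx
    intro h
    exact hf0 (by rw [← Ideal.mem_bot, ← h]; exact hf)
  have hmP : (m.map (C : R →+* R[X])).IsPrime := Ideal.isPrime_map_C_of_isPrime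
  have hIm : I < m.map (C : R →+* R[X]) := by
    refine lt_of_le_of_ne ?_ ?_
    · intro f hf
      rw [Ideal.mem_map_C_iff]
      intro i
      exact hcon f hf i
    · intro h
      obtain ⟨r, hr, hr0⟩ := Submodule.exists_mem_ne_zero_of_ne_bot hm
      have : C r ∈ I := by rw [h]; exact Ideal.mem_map_of_mem _ hr
      have h2 : algebraMap R K r = 0 := by simpa [I] using this
      exact hr0 ((FaithfulSMul.algebraMap_eq_zero_iff R K).1 h2)
  let J : Ideal R[X] := m.comap (constantCoeff : R[X] →+* R)
  have hJ : J.IsPrime := Ideal.IsPrime.comap _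
  have hmJ : m.map (C : R →+* R[X]) < J := by
    refine lt_of_le_of_ne ?_ ?_
    · rw [Ideal.map_le_iff_le_comap]
      intro r hr
      simpa [J] using hr
    · intro h
      have : (X : R[X]) ∈ J := by simp [J]
      rw [← h, Ideal.mem_map_C_iff] at this
      have h1 := this 1
      simp at h1
      exact (Ideal.IsPrime.ne_top (I := m) inferInstance) ((Ideal.eq_top_iff_one _).2 h1)
  have hd : ringKrullDim R[X] = 2 := by
    rw [Polynomial.ringKrullDim_of_isNoetherianRing, hdim]; rfl
  let p0 : PrimeSpectrum R[X] := ⟨⊥, Ideal.isPrime_bot⟩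
  let p1 : PrimeSpectrum R[X] := ⟨I, hIprime⟩
  let p2 : PrimeSpectrum R[X] := ⟨_, hmP⟩
  let p3 : PrimeSpectrum R[X] := ⟨J, hJ⟩
  have h01 : p0 < p1 := hI0
  have h12 : p1 < p2 := hIm
  have h23 : p2 < p3 := hmJ
  let s : LTSeries (PrimeSpectrum R[X]) :=
    LTSeries.mk 3 ![p0, p1, p2, p3] (by
      rw [Fin.strictMono_iff_lt_succ]
      intro i
      fin_cases i
      exacts [h01, h12, h23])
  have hs := Order.LTSeries.length_le_krullDim s
  change ((3 : ℕ) : WithBot ℕ∞) ≤ ringKrullDim R[X] at hs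
  rw [hd] at hs
  exact absurd (Nat.cast_le.1 hs : (3 : ℕ) ≤ 2) (by norm_num)

theorem aux_uu (A K : Type u) [CommRing A] [IsLocalRing A] [Field K] [Algebra A K]
    (hintegral : ∀ x : K, IsIntegral A x → ∃ a, algebraMap A K a = x) (x : K) (n : ℕ) :
    ∀ a : ℕ → A, (∑ i ∈ Finset.range (n + 1), algebraMap A K (a i) * x ^ i = 0) →
      (∃ i ≤ n, IsUnit (a i)) → (∃ b, algebraMap A K b = x) ∨ (∃ b, algebraMap A K b = x⁻¹) := by
  induction n with
  | zero =>
    rintro a h ⟨i, hi, hu⟩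
    obtain rfl : i = 0 := by omega
    simp at h
    exact absurd h (hu.map (algebraMap A K)).ne_zero
  | succ n ih =>
    rintro a h ⟨i, hi, hu⟩
    -- `a_{n+1} x` is integral
    have hb : IsIntegral A (algebraMap A K (a (n + 1)) * x) := by
      refine ⟨X ^ (n + 1) + ∑ i ∈ Finset.range (n + 1),
        C (a i * a (n + 1) ^ (n - i)) * X ^ i, ?_, ?_⟩
      · refine monic_X_pow_add ?_
        refine (degree_sum_le _ _).trans_lt ?_
        rw [Finset.sup_lt_iff (by exact WithBot.bot_lt_coe _)]
        intro j hj
        refine (degree_C_mul_X_pow_le _ _).trans_lt ?_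
        exact_mod_cast Finset.mem_range.1 hj
      · rw [eval₂_add, eval₂_X_pow, eval₂_finsetSum]
        have : algebraMap A K (a (n + 1)) ^ n *
          (∑ i ∈ Finset.range (n + 1 + 1), algebraMap A K (a i) * x ^ i) = 0 := by rw [h, mul_zero]
        rw [Finset.sum_range_succ, mul_add, add_comm, Finset.mul_sum] at this
        rw [← this]
        congr 1
        · ring
        · refine Finset.sum_congr rfl fun j hj => ?_
          have hj' : j ≤ n := by simpa [Nat.lt_succ_iff] using hj
          obtain ⟨k, rfl⟩ := Nat.exists_eq_add_of_le hj'
          simp only [eval₂_mul, eval₂_C, eval₂_X, map_mul, map_pow, eval₂_pow, Nat.add_sub_cancel_left]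
          ring
    obtain ⟨b, hb⟩ := hintegral _ hb
    by_cases hbu : IsUnit b
    · right
      obtain ⟨c, hc⟩ := hbu.exists_right_inv
      refine ⟨a (n + 1) * c, ?_⟩
      have h1 : algebraMap A K (a (n + 1) * c) * x = 1 := by
        rw [map_mul, mul_right_comm, ← hb, ← map_mul, hc, map_one]
      exact eq_inv_of_mul_eq_one_left h1
    by_cases hn : IsUnit (a (n + 1))
    · left
      obtain ⟨c, hc⟩ := hn.exists_left_inv
      refine ⟨c * b, ?_⟩
      rw [map_mul, hb, ← mul_assoc, ← map_mul, hc, map_one, one_mul]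
    have hin : i ≤ n := by
      rcases Nat.lt_or_eq_of_le hi with h' | h'
      · omega
      · subst h'; exact absurd hu hn
    refine ih (fun j => if j = n then a n + b else a j) ?_ ⟨i, hin, ?_⟩
    · rw [Finset.sum_range_succ, Finset.sum_range_succ] at h
      rw [Finset.sum_range_succ]
      rw [← h, add_assoc]
      congr 1
      · refine Finset.sum_congr rfl fun j hj => ?_
        have : j ≠ n := by have := Finset.mem_range.1 hj; omega
        simp [this]
      · simp only [if_true, map_add, hb]; ring
    · split_ifs with hin'
      · subst hin'
        by_contra hcon
        have hb' : b ∈ IsLocalRing.maximalIdeal A := hbu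
        have hc' : a i + b ∈ IsLocalRing.maximalIdeal A := hcon
        have := sub_mem hc' hb'
        rw [add_sub_cancel_right] at this
        exact this hu
      · exact hu

theorem aux_dense (A : Type u) [CommRing A] [IsDomain A]
    (hv : ∀ a b : A, a ∣ b ∨ b ∣ a) (t : A) (ht0 : t ≠ 0) (ht : ¬ IsUnit t) (s : ℕ → A)
    (hs : ∀ n, s n ^ (n + 1) = t)
    (hrad : ∀ a x : A, a ≠ 0 → ¬ IsUnit x → ∃ N, a ∣ x ^ N) :
    ∃ D : ℕ → A, (∀ n, D n ≠ 0) ∧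
      ∀ a c : A, a ≠ 0 → c ≠ 0 → ¬ IsUnit c → ∃ n, a ∣ D n ∧ D n ∣ a * c := by
  classical
  have hs0 : ∀ n, s n ≠ 0 := by
    intro n h
    apply ht0
    rw [← hs n, h, zero_pow (by omega)]
  have hsu : ∀ n, ¬ IsUnit (s n) := fun n h => ht (hs n ▸ h.pow (n + 1))
  refine ⟨fun k => s k.unpair.1 ^ k.unpair.2, fun n => pow_ne_zero _ (hs0 _), ?_⟩
  intro a c ha hc hcu
  obtain ⟨n, hn⟩ := hrad t c ht0 hcu
  have hn' : t ∣ c ^ (n + 1) := hn.trans (pow_dvd_pow c (by omega))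
  have hsc : s n ∣ c := by
    rcases hv (s n) c with h | ⟨w, hw⟩
    · exact h
    · obtain ⟨z, hz⟩ := hn'
      have h1 : c ^ (n + 1) * (w ^ (n + 1) * z) = c ^ (n + 1) * 1 := by
        rw [mul_one]
        conv_rhs => rw [hz, ← hs n, hw]
        ring
      have h2 := mul_left_cancel₀ (pow_ne_zero _ hc) h1
      have h3 : IsUnit w := by
        have : IsUnit (w ^ (n + 1)) := IsUnit.of_mul_eq_one _ h2
        exact (isUnit_pow_iff (by omega)).1 this
      rw [hw]
      exact h3.mul_right_dvd.2 dvd_rfl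
  have hex := hrad a (s n) ha (hsu n)
  obtain ⟨hm1, hm2⟩ : a ∣ s n ^ (Nat.find hex) ∧ s n ^ (Nat.find hex) ∣ a * c := by
    refine ⟨Nat.find_spec hex, ?_⟩
    rcases hk : Nat.find hex with _ | k
    · simp
    · have hk1 : ¬ a ∣ s n ^ k := Nat.find_min hex (by omega)
      rw [pow_succ]
      exact mul_dvd_mul ((hv _ _).resolve_left hk1) hsc
  refine ⟨Nat.pair n (Nat.find hex), ?_⟩
  simpa only [Nat.unpair_pair] using ⟨hm1, hm2⟩

end RingPart

theorem aux_fld1 {K : Type*} [Field K] (x y : K) (hx : x ≠ 0) : y = x * (y / x) := by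
  field_simp

theorem aux_fld2 {K : Type*} [Field K] (x y : K) (hy : y ≠ 0) : x = y * (y / x)⁻¹ := by
  field_simp

/-- Let `(R, m)` be a one-dimensional Noetherian complete local domain
whose residue field has prime characteristic `p`. Then `R⁺` is quasi-local with a unique
maximal ideal `m_{R⁺}`, and `gldim(R⁺) = pd_{R⁺}(R⁺/m_{R⁺}) = 2`. -/
theorem stmt_1 (R : Type u) [CommRing R] [IsDomain R] [IsNoetherianRing R]
    [IsLocalRing R] [IsAdicComplete (IsLocalRing.maximalIdeal R) R]
    (hdim : ringKrullDim R = 1) (p : ℕ) (hp : p.Prime)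
    [CharP (IsLocalRing.ResidueField R) p] :
    ∃ h : IsLocalRing (RPlus R),
      gldim (RPlus R) = 2 ∧
      projDim (RPlus R) (RPlus R ⧸ @IsLocalRing.maximalIdeal (RPlus R) _ h) = 2 := by
  classical
  let K := AlgebraicClosure (FractionRing R)
  have hloc : IsLocalRing (RPlus R) := aux_local R (RPlus R)
  refine ⟨hloc, ?_⟩
  have hKD : Ring.KrullDimLE 1 R := Ring.krullDimLE_iff.2 hdim.le
  have hD1 : Ring.DimensionLEOne R :=
    ⟨fun {p} h0 hp => Ring.krullDimLE_one_iff_of_noZeroDivisors.1 hKD p h0 hp⟩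
  have hD1A : Ring.DimensionLEOne (RPlus R) := Ring.DimensionLEOne.integralClosure R _
  have hinj : Function.Injective (algebraMap R K) := by
    rw [IsScalarTower.algebraMap_eq R (FractionRing R) K]
    exact (algebraMap (FractionRing R) K).injective.comp (IsFractionRing.injective R _)
  have hfaith : FaithfulSMul R K := (faithfulSMul_iff_algebraMap_injective R K).2 hinj
  have hm : IsLocalRing.maximalIdeal R ≠ ⊥ := by
    intro h
    have hf := IsLocalRing.isField_iff_maximalIdeal_eq.2 h
    rw [ringKrullDim_eq_zero_of_isField hf] at hdim
    exact absurd hdim (by norm_num)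
  have hintegral : ∀ x : K, IsIntegral (RPlus R) x → ∃ a, algebraMap (RPlus R) K a = x := by
    intro x hx
    have : IsIntegral R x := isIntegral_trans x hx
    exact ⟨⟨x, this⟩, rfl⟩
  have halg : ∀ x : K, IsAlgebraic R x := by
    intro x
    exact (IsFractionRing.isAlgebraic_iff R (FractionRing R) K).2
      (Algebra.IsAlgebraic.isAlgebraic x)
  have hval : ∀ x : K, (∃ b, algebraMap (RPlus R) K b = x) ∨
      (∃ b, algebraMap (RPlus R) K b = x⁻¹) := by
    intro x
    obtain ⟨f, hf, i, hi⟩ := aux_poly R K hdim hm x (halg x)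
    refine aux_uu (RPlus R) K hintegral x f.natDegree (fun j => algebraMap R (RPlus R) (f.coeff j))
      ?_ ⟨i, ?_, hi.map _⟩
    · rw [Polynomial.aeval_eq_sum_range] at hf
      rw [← hf]
      refine Finset.sum_congr rfl fun j _ => ?_
      rw [Algebra.smul_def]
      rfl
    · exact Polynomial.le_natDegree_of_ne_zero hi.ne_zero
  have hAinj : Function.Injective (algebraMap (RPlus R) K) := Subtype.val_injective
  have hv : ∀ a b : RPlus R, a ∣ b ∨ b ∣ a := by
    intro a b
    by_cases ha : a = 0
    · exact Or.inr (ha ▸ dvd_zero _)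
    by_cases hb : b = 0
    · exact Or.inl (hb ▸ dvd_zero _)
    have ha' : algebraMap (RPlus R) K a ≠ 0 := (map_ne_zero_iff _ hAinj).2 ha
    have hb' : algebraMap (RPlus R) K b ≠ 0 := (map_ne_zero_iff _ hAinj).2 hb
    rcases hval (algebraMap (RPlus R) K b / algebraMap (RPlus R) K a) with ⟨c, hc⟩ | ⟨c, hc⟩
    · left
      refine ⟨c, hAinj ?_⟩
      rw [map_mul, hc]; exact aux_fld1 _ _ ha'
    · right
      refine ⟨c, hAinj ?_⟩
      rw [map_mul, hc]; exact aux_fld2 _ _ hb'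
  have hroot : ∀ (a : RPlus R) (n : ℕ), ∃ b : RPlus R, b ^ (n + 1) = a := by
    intro a n
    obtain ⟨z, hz⟩ := IsAlgClosed.exists_pow_nat_eq (algebraMap (RPlus R) K a)
      (Nat.succ_pos n)
    have hzi : IsIntegral R z := by
      refine IsIntegral.of_pow (Nat.succ_pos n) ?_
      rw [hz]
      exact a.2
    exact ⟨⟨z, hzi⟩, hAinj hz⟩
  obtain ⟨t, htm, ht0⟩ := Submodule.exists_mem_ne_zero_of_ne_bot hm
  have hRA : Function.Injective (algebraMap R (RPlus R)) := by
    intro x y hxy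
    exact hinj (congrArg (algebraMap (RPlus R) K) hxy)
  have htA0 : algebraMap R (RPlus R) t ≠ 0 := (map_ne_zero_iff _ hRA).2 ht0
  have htA : algebraMap R (RPlus R) t ∈ IsLocalRing.maximalIdeal (RPlus R) := by
    have hcomap : (IsLocalRing.maximalIdeal (RPlus R)).comap (algebraMap R (RPlus R)) =
        IsLocalRing.maximalIdeal R :=
      IsLocalRing.eq_maximalIdeal (Ideal.isMaximal_comap_of_isIntegral_of_isMaximal _)
    rw [← Ideal.mem_comap, hcomap]; exact htm
  have hrad : ∀ a x : RPlus R, a ≠ 0 → ¬ IsUnit x → ∃ N, a ∣ x ^ N := by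
    intro a x ha hx
    have : x ∈ (Ideal.span {a}).radical := by
      rw [Ideal.radical_eq_sInf, Ideal.mem_sInf]
      rintro P ⟨hP, hPp⟩
      have hP0 : P ≠ ⊥ := by
        rintro rfl
        exact ha (by simpa using hP)
      rw [IsLocalRing.eq_maximalIdeal (hPp.isMaximal hP0)]
      exact hx
    obtain ⟨N, hN⟩ := this
    exact ⟨N, Ideal.mem_span_singleton.1 hN⟩
  choose s hs using hroot (algebraMap R (RPlus R) t)
  obtain ⟨D, hD0, hD⟩ := aux_dense (RPlus R) hv _ htA0 htA s hs hrad
  refine aux_main (RPlus R) hv D hD0 hD (fun a => hroot a 1) ?_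
  intro h
  rw [h] at htA
  exact htA0 (by simpa using htA)
end

section
/- Let (R, m) be a Noetherian local domain of prime characteristic p with Krull dimension dim R ≤ 2. Then sup{pd_{R_∞}(R_∞/P) : P a prime ideal of R_∞} < ∞. -/
set_option synthInstance.maxHeartbeats 400000
set_option maxHeartbeats 1000000

universe u

open CategoryTheory CategoryTheory.Limits

/-- The perfect closure `R_∞ = {x ∈ R⁺ : x ^ (p ^ n) ∈ R for some n ≥ 0}` of a domain
`R` of prime characteristic `p`, realized as a subring of an algebraic closure of the
fraction field of `R` (every element with `x ^ (p ^ n) ∈ R` is automatically integral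
over `R`, so this set coincides with the corresponding subset of `R⁺`). -/
def RInfSubring (R : Type u) [CommRing R] [IsDomain R] (p : ℕ) (hp : p.Prime)
    [CharP R p] : Subring (AlgebraicClosure (FractionRing R)) where
  carrier := {x | ∃ (n : ℕ) (r : R),
    algebraMap R (AlgebraicClosure (FractionRing R)) r = x ^ p ^ n}
  zero_mem' := ⟨0, 0, by simp⟩
  one_mem' := ⟨0, 1, by simp⟩
  mul_mem' := by
    rintro a b ⟨n, r, hr⟩ ⟨m, s, hs⟩
    refine ⟨n + m, r ^ p ^ m * s ^ p ^ n, ?_⟩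
    rw [map_mul, map_pow, map_pow, hr, hs, mul_pow, ← pow_mul, ← pow_mul,
      ← pow_add, ← pow_add, Nat.add_comm m n]
  add_mem' := by
    haveI : CharP (FractionRing R) p :=
      charP_of_injective_algebraMap (IsFractionRing.injective R (FractionRing R)) p
    haveI : CharP (AlgebraicClosure (FractionRing R)) p :=
      charP_of_injective_algebraMap
        (algebraMap (FractionRing R) (AlgebraicClosure (FractionRing R))).injective p
    haveI := Fact.mk hp
    haveI : ExpChar (AlgebraicClosure (FractionRing R)) p := .prime hp
    rintro a b ⟨n, r, hr⟩ ⟨m, s, hs⟩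
    refine ⟨n + m, r ^ p ^ m + s ^ p ^ n, ?_⟩
    rw [map_add, map_pow, map_pow, hr, hs, add_pow_char_pow, ← pow_mul, ← pow_mul,
      ← pow_add, ← pow_add, Nat.add_comm m n]
  neg_mem' := by
    rintro a ⟨n, r, hr⟩
    rcases Nat.even_or_odd (p ^ n) with he | ho
    · exact ⟨n, r, by rw [hr, he.neg_pow]⟩
    · exact ⟨n, -r, by rw [map_neg, hr, ho.neg_pow]⟩

/-- The perfect closure `R_∞` as a type. -/
abbrev RInf (R : Type u) [CommRing R] [IsDomain R] (p : ℕ) (hp : p.Prime) [CharP R p] :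
    Type u := ↥(RInfSubring R p hp)

/-- The canonical injection `R →+* R_∞`. -/
noncomputable def toRInf (R : Type u) [CommRing R] [IsDomain R] (p : ℕ) (hp : p.Prime)
    [CharP R p] : R →+* RInf R p hp :=
  (algebraMap R (AlgebraicClosure (FractionRing R))).codRestrict
    (RInfSubring R p hp).toSubsemiring (fun r => ⟨0, r, by simp⟩)

/-- Exactness packaged for `ModuleCat`. -/
lemma se_aux {A : Type u} [CommRing A] {L M N : Type u} [AddCommGroup L] [AddCommGroup M]
    [AddCommGroup N] [Module A L] [Module A M] [Module A N] (f : L →ₗ[A] M) (g : M →ₗ[A] N)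
    (hf : Function.Injective f) (hg : Function.Surjective g) (h : Function.Exact f g) :
    (ModuleCat.shortComplexOfCompEqZero f g h.linearMap_comp_eq_zero).ShortExact :=
  ModuleCat.shortComplex_shortExact _ h hf hg

lemma pd_prod_aux {A : Type u} [CommRing A] {L M : Type u} [AddCommGroup L] [AddCommGroup M]
    [Module A L] [Module A M] (n : ℕ) (h1 : HasProjectiveDimensionLT (ModuleCat.of A L) n)
    (h2 : HasProjectiveDimensionLT (ModuleCat.of A M) n) :
    HasProjectiveDimensionLT (ModuleCat.of A (L × M)) n :=
  (se_aux (LinearMap.inl A L M) (LinearMap.snd A L M) LinearMap.inl_injective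
    LinearMap.snd_surjective .inl_snd).hasProjectiveDimensionLT_X₂ n h1 h2

lemma hasPdLE_of_lt {A : Type u} [CommRing A] (n : ℕ) : ∀ (M : ModuleCat.{u} A),
    HasProjectiveDimensionLT M (n + 1) → hasPdLE A n M := by
  induction n with
  | zero => intro M h; exact projective_iff_hasProjectiveDimensionLT_one.2 h
  | succ n ih =>
    intro M h
    refine ⟨Projective.over M, Projective.π M, inferInstance, inferInstance, ih _ ?_⟩
    have hS : (ShortComplex.mk (kernel.ι (Projective.π M)) (Projective.π M)
        (kernel.condition _)).ShortExact :=
      { exact := ShortComplex.exact_kernel _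
        mono_f := by dsimp; infer_instance
        epi_g := by dsimp; infer_instance }
    exact hS.hasProjectiveDimensionLT_X₁ (n + 1)
      (hasProjectiveDimensionLT_of_ge (Projective.over M) 1 _ (by omega)) h

/-- The telescope map. -/
noncomputable def teleD {A : Type u} [CommRing A] (c : ℕ → A) : (ℕ →₀ A) →ₗ[A] (ℕ →₀ A) :=
  Finsupp.lsum A fun n => LinearMap.toSpanSingleton A _
    (Finsupp.single n 1 - Finsupp.single (n + 1) (c n))

lemma teleD_single {A : Type u} [CommRing A] (c : ℕ → A) (n : ℕ) (b : A) :
    teleD c (Finsupp.single n b) = Finsupp.single n b - Finsupp.single (n + 1) (b * c n) := by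
  simp [teleD, smul_sub]

lemma teleD_apply_zero {A : Type u} [CommRing A] (c : ℕ → A) (f : ℕ →₀ A) :
    teleD c f 0 = f 0 := by
  induction f using Finsupp.induction_linear with
  | zero => simp
  | add f g hf hg => simp [hf, hg]
  | single n b => simp [teleD_single]

lemma teleD_apply_succ {A : Type u} [CommRing A] (c : ℕ → A) (f : ℕ →₀ A) (k : ℕ) :
    teleD c f (k + 1) = f (k + 1) - f k * c k := by
  induction f using Finsupp.induction_linear with
  | zero => simp
  | add f g hf hg => simp [hf, hg]; ring
  | single n b =>
    by_cases h : n = k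
    · subst h; simp [teleD_single, Finsupp.single_apply]
    · simp [teleD_single, Finsupp.single_apply, h]

lemma teleD_inj {A : Type u} [CommRing A] (c : ℕ → A) : Function.Injective (teleD c) := by
  rw [injective_iff_map_eq_zero]
  intro f hf
  ext n
  induction n with
  | zero => rw [← teleD_apply_zero c f, hf]
  | succ n ih =>
    have := teleD_apply_succ c f n
    rw [hf, ih] at this
    simpa using this.symm

lemma tele_push {A : Type u} [CommRing A] (c : ℕ → A) (f : ℕ →₀ A) :
    ∃ N, ∀ M, N ≤ M → ∃ h b, f - teleD c h = Finsupp.single M b := by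
  induction f using Finsupp.induction_linear with
  | zero => exact ⟨0, fun M _ => ⟨0, 0, by simp⟩⟩
  | add f g hf hg =>
    obtain ⟨N, hN⟩ := hf
    obtain ⟨N', hN'⟩ := hg
    refine ⟨max N N', fun M hM => ?_⟩
    obtain ⟨h, b, e⟩ := hN M (le_trans (le_max_left _ _) hM)
    obtain ⟨h', b', e'⟩ := hN' M (le_trans (le_max_right _ _) hM)
    refine ⟨h + h', b + b', ?_⟩
    rw [map_add, Finsupp.single_add, ← e, ← e']
    abel
  | single n a =>
    refine ⟨n, fun M hM => ?_⟩
    induction M, hM using Nat.le_induction with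
    | base => exact ⟨0, a, by simp⟩
    | succ M hM ih =>
      obtain ⟨h, b, e⟩ := ih
      refine ⟨h + Finsupp.single M b, b * c M, ?_⟩
      rw [map_add, teleD_single, ← sub_sub, e]
      abel

lemma tele_pd {A : Type u} [CommRing A] [IsDomain A] (a c : ℕ → A) (I : Ideal A)
    (h0 : ∀ n, a n ≠ 0) (hc : ∀ n, a n = c n * a (n + 1))
    (hI : ∀ z, z ∈ I ↔ ∃ n b, z = b * a n) :
    HasProjectiveDimensionLT (ModuleCat.of A I) 2 := by
  let g : (ℕ →₀ A) →ₗ[A] I := Finsupp.lsum A fun n => LinearMap.toSpanSingleton A I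
    ⟨a n, (hI _).2 ⟨n, 1, by simp⟩⟩
  have hgs : ∀ n b, ((g (Finsupp.single n b) : I) : A) = b * a n := by
    intro n b; simp [g]
  have hgD : ∀ f, g (teleD c f) = 0 := by
    intro f
    induction f using Finsupp.induction_linear with
    | zero => simp
    | add f g hf hg => simp [hf, hg]
    | single n b =>
      apply Subtype.ext
      rw [teleD_single, map_sub, AddSubgroupClass.coe_sub, hgs, hgs, hc n]
      simp; ring
  have hex : Function.Exact (teleD c) g := by
    intro f
    constructor
    · intro hf
      obtain ⟨N, hN⟩ := tele_push c f
      obtain ⟨h, b, e⟩ := hN N le_rfl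
      refine ⟨h, ?_⟩
      have h1 : g (Finsupp.single N b) = 0 := by rw [← e, map_sub, hf, hgD, sub_zero]
      have h2 := hgs N b
      rw [h1] at h2
      have h3 : b = 0 := by
        rcases mul_eq_zero.1 h2.symm with h | h
        · exact h
        · exact absurd h (h0 N)
      rw [h3, Finsupp.single_zero, sub_eq_zero] at e
      exact e.symm
    · rintro ⟨h, rfl⟩; exact hgD h
  have hsurj : Function.Surjective g := by
    rintro ⟨z, hz⟩
    obtain ⟨n, b, rfl⟩ := (hI z).1 hz
    exact ⟨Finsupp.single n b, Subtype.ext (hgs n b)⟩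
  have hP : Projective (ModuleCat.of A (ℕ →₀ A)) := inferInstance
  exact (se_aux (teleD c) g (teleD_inj c) hsurj hex).hasProjectiveDimensionLT_X₃ 1
    (projective_iff_hasProjectiveDimensionLT_one.1 hP)
    (hasProjectiveDimensionLT_of_ge (ModuleCat.of A (ℕ →₀ A)) 1 _ (by omega))

section perfect

variable {A : Type u} [CommRing A] [IsDomain A] (p : ℕ) [Fact p.Prime] [CharP A p]

lemma exists_root (hs : ∀ a : A, ∃ b : A, b ^ p = a) (n : ℕ) (a : A) :
    ∃ b : A, b ^ p ^ n = a := by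
  induction n with
  | zero => exact ⟨a, by simp⟩
  | succ n ih =>
    obtain ⟨b, rfl⟩ := ih
    obtain ⟨d, rfl⟩ := hs b
    exact ⟨d, by rw [← pow_mul, pow_succ']⟩

lemma root_inj (n : ℕ) (a b : A) (h : a ^ p ^ n = b ^ p ^ n) : a = b := by
  have := sub_pow_char_pow (n := n) (p := p) (x := a) (y := b)
  rw [h, sub_self] at this
  exact sub_eq_zero.1 ((pow_eq_zero_iff (pow_pos (Fact.out : p.Prime).pos n).ne').1 this)

lemma mem_radical_pp (I : Ideal A) (z : A) (hz : z ∈ I.radical) : ∃ n, z ^ p ^ n ∈ I := by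
  obtain ⟨k, hk⟩ := hz
  exact ⟨k, I.pow_mem_of_pow_mem hk (Nat.lt_pow_self (Fact.out : p.Prime).one_lt).le⟩

lemma radical_pd (hs : ∀ a : A, ∃ b : A, b ^ p = a) (x : A) :
    HasProjectiveDimensionLT (ModuleCat.of A (Ideal.span {x}).radical) 2 := by
  by_cases hx : x = 0
  · subst hx
    have : Subsingleton (Ideal.span {(0 : A)}).radical := by
      refine ⟨fun a b => Subtype.ext ?_⟩
      have hz : ∀ z ∈ (Ideal.span {(0 : A)}).radical, z = 0 := by
        rintro z ⟨n, hn⟩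
        rw [Ideal.span_singleton_zero, Ideal.mem_bot] at hn
        exact eq_zero_of_pow_eq_zero hn
      rw [hz _ a.2, hz _ b.2]
    have := (ModuleCat.isZero_of_subsingleton
      (ModuleCat.of A (Ideal.span {(0 : A)}).radical)).hasProjectiveDimensionLT_zero
    exact hasProjectiveDimensionLT_of_ge _ 0 2 (by omega)
  choose r hr using hs
  let a : ℕ → A := fun n => r^[n] x
  have ha : ∀ n, a (n + 1) ^ p = a n := by
    intro n; simp only [a, Function.iterate_succ_apply', hr]
  have hap : ∀ n, a n ^ p ^ n = x := by
    intro n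
    induction n with
    | zero => simp [a]
    | succ n ih => rw [pow_succ', pow_mul, ha, ih]
  have hp := (Fact.out : p.Prime).pos
  refine tele_pd a (fun n => a (n + 1) ^ (p - 1)) _ ?_ ?_ ?_
  · intro n h
    apply hx
    rw [← hap n, h, zero_pow (pow_pos hp n).ne']
  · intro n
    rw [← pow_succ, Nat.sub_add_cancel hp, ha]
  · intro z
    constructor
    · intro hz
      obtain ⟨n, hn⟩ := mem_radical_pp p _ z hz
      obtain ⟨b, hb⟩ := Ideal.mem_span_singleton'.1 hn
      obtain ⟨d, rfl⟩ := exists_root p (fun a => ⟨r a, hr a⟩) n b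
      refine ⟨n, d, root_inj p n _ _ ?_⟩
      rw [← hb, mul_pow, hap]
    · rintro ⟨n, b, rfl⟩
      exact ⟨p ^ n, by rw [mul_pow, hap]; exact Ideal.mul_mem_left _ _ (Ideal.mem_span_singleton_self x)⟩

lemma sup_pd (I J : Ideal A) (hI : HasProjectiveDimensionLT (ModuleCat.of A I) 2)
    (hJ : HasProjectiveDimensionLT (ModuleCat.of A J) 2)
    (hIJ : HasProjectiveDimensionLT (ModuleCat.of A (I ⊓ J : Ideal A)) 2) :
    HasProjectiveDimensionLT (ModuleCat.of A (A ⧸ I ⊔ J)) 4 := by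
  let f : (I ⊓ J : Ideal A) →ₗ[A] I × J :=
    (Submodule.inclusion inf_le_left).prod (-(Submodule.inclusion inf_le_right))
  let g : I × J →ₗ[A] (I ⊔ J : Ideal A) :=
    (Submodule.inclusion le_sup_left).coprod (Submodule.inclusion le_sup_right)
  have hf : Function.Injective f := by
    intro a b h
    have := congrArg (fun t => ((t.1 : I) : A)) h
    exact Subtype.ext this
  have hg : Function.Surjective g := by
    rintro ⟨z, hz⟩
    obtain ⟨a, ha, b, hb, rfl⟩ := Submodule.mem_sup.1 hz
    exact ⟨(⟨a, ha⟩, ⟨b, hb⟩), rfl⟩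
  have hfg : Function.Exact f g := by
    rintro ⟨⟨a, ha⟩, ⟨b, hb⟩⟩
    constructor
    · intro h
      have h1 : a + b = 0 := congrArg Subtype.val h
      have h2 : b = -a := (neg_eq_of_add_eq_zero_right h1).symm
      subst h2
      exact ⟨⟨a, ha, by simpa using J.neg_mem hb⟩, rfl⟩
    · rintro ⟨⟨z, hz⟩, h⟩
      rw [← h]
      apply Subtype.ext
      change z + -z = 0
      simp
  have h3 : HasProjectiveDimensionLT (ModuleCat.of A (I ⊔ J : Ideal A)) 3 :=
    (se_aux f g hf hg hfg).hasProjectiveDimensionLT_X₃ 2 hIJ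
      (have := pd_prod_aux 2 hI hJ; hasProjectiveDimensionLT_of_ge _ 2 3 (by omega))
  have hP : Projective (ModuleCat.of A A) := inferInstance
  exact (se_aux (Submodule.subtype (I ⊔ J)) (Submodule.mkQ (I ⊔ J)) Subtype.val_injective
    (Submodule.mkQ_surjective _) (LinearMap.exact_subtype_mkQ _)).hasProjectiveDimensionLT_X₃ 3 h3
    (hasProjectiveDimensionLT_of_ge (ModuleCat.of A A) 1 _ (by omega))

lemma two_pd (hs : ∀ a : A, ∃ b : A, b ^ p = a) (x y : A) :
    HasProjectiveDimensionLT (ModuleCat.of A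
      (A ⧸ (Ideal.span {x}).radical ⊔ (Ideal.span {y}).radical)) 4 := by
  refine sup_pd _ _ (radical_pd p hs x) (radical_pd p hs y) ?_
  rw [← Ideal.radical_mul, Ideal.span_singleton_mul_span_singleton]
  exact radical_pd p hs (x * y)

end perfect

/-- A prime in a Noetherian local domain of dimension at most two is the radical of an ideal
with two generators. -/
lemma prime_two_gen {R : Type u} [CommRing R] [IsDomain R] [IsNoetherianRing R]
    [IsLocalRing R] (hdim : ringKrullDim R ≤ 2) (P : Ideal R) (hP : P.IsPrime) :
    ∃ x ∈ P, ∃ y ∈ P, P ≤ (Ideal.span {x, y}).radical := by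
  by_cases h0 : P = ⊥
  · subst h0
    exact ⟨0, zero_mem _, 0, zero_mem _, bot_le⟩
  obtain ⟨x, hxP, hx0⟩ := Submodule.exists_mem_ne_zero_of_ne_bot h0
  let S : Set (Ideal R) := {q | q ∈ (Ideal.span {x}).minimalPrimes ∧ ¬ P ≤ q}
  have hS : S.Finite := ((Ideal.span {x}).finite_minimalPrimes_of_isNoetherianRing R).subset
    fun _ h => h.1
  have hav : ¬ (P : Set R) ⊆ ⋃ K ∈ (hS.toFinset : Set (Ideal R)), (K : Set R) := by
    refine (Ideal.subset_union_prime (f := id) ⊥ ⊥ ?_).not.mpr ?_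
    · intro K hK _ _
      exact ((Set.Finite.mem_toFinset hS).1 hK).1.1.1
    · rintro ⟨K, hK, hle⟩
      exact ((Set.Finite.mem_toFinset hS).1 hK).2 hle
  obtain ⟨y, hyP, hy⟩ := Set.not_subset.1 hav
  have hy' : ∀ q ∈ S, y ∉ q := by
    intro q hq hyq
    apply hy
    simp only [Set.mem_iUnion]
    exact ⟨q, by simpa using hq, hyq⟩
  refine ⟨x, hxP, y, hyP, ?_⟩
  rw [Ideal.radical_eq_sInf]
  refine le_sInf ?_
  rintro Q ⟨hQ, hQp⟩
  by_contra hPQ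
  have hxQ : Ideal.span {x} ≤ Q := (Ideal.span_mono (by simp)).trans hQ
  have hyQ : y ∈ Q := hQ (Ideal.subset_span (by simp))
  obtain ⟨q, hq, hqQ⟩ := Ideal.exists_minimalPrimes_le hxQ
  have hqp : q.IsPrime := hq.1.1
  have hPq : ¬ P ≤ q := fun h => hPQ (h.trans hqQ)
  have h1 : q < Q := lt_of_le_of_ne hqQ (by
    rintro rfl
    exact hy' q ⟨hq, hPq⟩ hyQ)
  have h2 : ⊥ < q := bot_lt_iff_ne_bot.2 (by
    rintro rfl
    have : x ∈ (⊥ : Ideal R) := hq.1.2 (Ideal.mem_span_singleton_self x)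
    exact hx0 (by simpa using this))
  have h3 : Q < IsLocalRing.maximalIdeal R :=
    lt_of_le_of_ne (IsLocalRing.le_maximalIdeal hQp.ne_top) (by
      rintro rfl
      exact hPQ (IsLocalRing.le_maximalIdeal hP.ne_top))
  let v0 : PrimeSpectrum R := ⟨⊥, Ideal.isPrime_bot⟩
  let v1 : PrimeSpectrum R := ⟨q, hqp⟩
  let v2 : PrimeSpectrum R := ⟨Q, hQp⟩
  let v3 : PrimeSpectrum R := ⟨IsLocalRing.maximalIdeal R, inferInstance⟩
  have h2' : v0 < v1 := h2
  have h1' : v1 < v2 := h1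
  have h3' : v2 < v3 := h3
  let s : LTSeries (PrimeSpectrum R) :=
    (((RelSeries.singleton _ v0).snoc v1 (by simpa using h2')).snoc v2 (by rw [RelSeries.last_snoc]; exact h1')).snoc v3
      (by rw [RelSeries.last_snoc]; exact h3')
  have hs := (Order.LTSeries.length_le_krullDim s).trans hdim
  have hl : s.length = 3 := rfl
  rw [hl] at hs
  exact absurd hs (by decide)

section rinf

variable (R : Type u) [CommRing R] [IsDomain R] (p : ℕ) (hp : p.Prime) [CharP R p]

lemma toRInf_injective : Function.Injective (toRInf R p hp) := by
  intro a b h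
  have h1 : algebraMap R (AlgebraicClosure (FractionRing R)) a = algebraMap R _ b :=
    congrArg Subtype.val h
  rw [IsScalarTower.algebraMap_apply R (FractionRing R) (AlgebraicClosure (FractionRing R)),
    IsScalarTower.algebraMap_apply R (FractionRing R) (AlgebraicClosure (FractionRing R))] at h1
  exact IsFractionRing.injective R (FractionRing R)
    ((algebraMap (FractionRing R) (AlgebraicClosure (FractionRing R))).injective h1)

lemma rinf_pow_mem (x : RInf R p hp) : ∃ n r, toRInf R p hp r = x ^ p ^ n := by
  obtain ⟨x, n, r, h⟩ := x
  exact ⟨n, r, Subtype.ext h⟩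

lemma rinf_root (x : RInf R p hp) : ∃ y : RInf R p hp, y ^ p = x := by
  obtain ⟨x, n, r, h⟩ := x
  obtain ⟨y, hy⟩ := IsAlgClosed.exists_pow_nat_eq x hp.pos
  refine ⟨⟨y, n + 1, r, ?_⟩, Subtype.ext hy⟩
  rw [h, pow_succ', pow_mul, hy]

end rinf

/-- Let `(R, m)` be a Noetherian local domain of prime characteristic
`p` with `dim R ≤ 2`. Then `sup{pd_{R_∞}(R_∞/P) : P ∈ Spec R_∞} < ∞`. -/
theorem stmt_3 (R : Type u) [CommRing R] [IsDomain R] [IsNoetherianRing R]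
    [IsLocalRing R] (p : ℕ) (hp : p.Prime) [CharP R p]
    (hdim : ringKrullDim R ≤ 2) :
    (⨆ P : {P : Ideal (RInf R p hp) // P.IsPrime},
      projDim (RInf R p hp) (RInf R p hp ⧸ P.1)) < ⊤ := by
  haveI := Fact.mk hp
  haveI : CharP (RInf R p hp) p := charP_of_injective_ringHom (toRInf_injective R p hp) p
  refine lt_of_le_of_lt (iSup_le (a := ((3 : ℕ) : ℕ∞)) ?_) (ENat.natCast_lt_top 3)
  rintro ⟨P, hP⟩
  refine sInf_le ⟨3, rfl, hasPdLE_of_lt 3 _ ?_⟩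
  obtain ⟨x, hx, y, hy, hle⟩ := prime_two_gen hdim (P.comap (toRInf R p hp)) inferInstance
  have hPeq : P = (Ideal.span {toRInf R p hp x}).radical ⊔
      (Ideal.span {toRInf R p hp y}).radical := by
    apply le_antisymm
    · intro z hz
      obtain ⟨n, r, hr⟩ := rinf_pow_mem R p hp z
      have hrP : r ∈ P.comap (toRInf R p hp) := by
        rw [Ideal.mem_comap, hr]
        exact P.pow_mem_of_mem hz _ (pow_pos hp.pos n)
      obtain ⟨m, hm⟩ := mem_radical_pp p _ r (hle hrP)
      obtain ⟨a, b, hab⟩ := Ideal.mem_span_pair.1 hm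
      have hz' : z ^ p ^ (n + m) = toRInf R p hp a * toRInf R p hp x +
          toRInf R p hp b * toRInf R p hp y := by
        rw [pow_add, pow_mul, ← hr, ← map_pow, ← hab, map_add, map_mul, map_mul]
      have hs := rinf_root R p hp
      obtain ⟨a', ha⟩ := exists_root p hs (n + m) (toRInf R p hp a * toRInf R p hp x)
      obtain ⟨b', hb⟩ := exists_root p hs (n + m) (toRInf R p hp b * toRInf R p hp y)
      have hzz : z = a' + b' := by
        apply root_inj p (n + m)
        rw [add_pow_char_pow, ha, hb, hz']
      rw [hzz]
      refine Submodule.add_mem_sup ⟨p ^ (n + m), ?_⟩ ⟨p ^ (n + m), ?_⟩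
      · rw [ha]; exact Ideal.mul_mem_left _ _ (Ideal.mem_span_singleton_self _)
      · rw [hb]; exact Ideal.mul_mem_left _ _ (Ideal.mem_span_singleton_self _)
    · refine sup_le ?_ ?_ <;>
      · rw [hP.radical_le_iff, Ideal.span_singleton_le_iff_mem]
        assumption
  have := two_pd p (rinf_root R p hp) (toRInf R p hp x) (toRInf R p hp y)
  rw [← hPeq] at this
  exact this
end

section
/- Let A be an ℵ_n-Noetherian ring for some integer n ≥ -1. Then gldim(A) < ∞ if and only if sup{pd_A(A/a) : a a finitely generated ideal of A} < ∞. -/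
set_option synthInstance.maxHeartbeats 400000
set_option maxHeartbeats 1000000

universe u

open CategoryTheory CategoryTheory.Limits

/-- A ring `A` is `ℵ_n`-Noetherian (for an integer `n ≥ -1`) if every ideal of `A` is
generated by a set of cardinality at most `ℵ_n`, where `ℵ_{-1}`-Noetherian means every
ideal is generated by a finite set (i.e. `A` is Noetherian). -/
def AlephNoetherian (A : Type u) [CommRing A] (n : ℤ) : Prop :=
  ∀ I : Ideal A, ∃ S : Set A, I = Ideal.span S ∧
    (if 0 ≤ n then Cardinal.mk S ≤ Cardinal.aleph n.toNat else S.Finite)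


open Cardinal in
/-- Every linear map from an ideal generated by fewer than `ℵ_k` elements into `N` extends. -/
def ExtendsBelow (A : Type u) [CommRing A] (k : ℕ) (N : Type u) [AddCommGroup N] [Module A N] :
    Prop :=
  ∀ S : Set A, #S < aleph k → ∀ g : Ideal.span S →ₗ[A] N,
    ∃ g' : A →ₗ[A] N, ∀ (x : A) (hx : x ∈ Ideal.span S), g' x = g ⟨x, hx⟩

section step
open Cardinal

variable {A : Type u} [CommRing A] {N E C : Type u} [AddCommGroup N] [Module A N]
  [AddCommGroup E] [Module A E] [AddCommGroup C] [Module A C]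

theorem lift_step (i : N →ₗ[A] E) (p : E →ₗ[A] C) (hi : Function.Injective i)
    (hp : Function.Surjective p) (hip : ∀ e, p e = 0 ↔ ∃ n, i n = e) (k : ℕ)
    (hN : ExtendsBelow A k N) (hC : ExtendsBelow A k C)
    (S T : Set A) (hS : #S < aleph k) (hT : #T < aleph k) (hST : S ⊆ T)
    (f : Ideal.span T →ₗ[A] C) (g : Ideal.span S →ₗ[A] E)
    (hg : ∀ (x : A) (hx : x ∈ Ideal.span S),
      p (g ⟨x, hx⟩) = f ⟨x, Ideal.span_mono hST hx⟩) :
    ∃ g' : A →ₗ[A] E, (∀ (x : A) (hx : x ∈ Ideal.span T), p (g' x) = f ⟨x, hx⟩) ∧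
      ∀ (x : A) (hx : x ∈ Ideal.span S), g' x = g ⟨x, hx⟩ := by
  obtain ⟨F, hF⟩ := hC T hT f
  obtain ⟨e, he⟩ := hp (F 1)
  let G : A →ₗ[A] E := LinearMap.toSpanSingleton A E e
  have hG : ∀ x, p (G x) = F x := by
    intro x
    simp only [G, LinearMap.toSpanSingleton_apply, map_smul, he]
    rw [← map_smul]; simp
  let δ : Ideal.span S →ₗ[A] E := G ∘ₗ (Ideal.span S).subtype - g
  have hδ : ∀ x, δ x ∈ LinearMap.range i := by
    intro x
    obtain ⟨n, hn⟩ := (hip (δ x)).1 (by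
      simp only [δ, LinearMap.sub_apply, LinearMap.comp_apply, map_sub, hG, Submodule.subtype_apply]
      rw [hF x.1 (Ideal.span_mono hST x.2), hg x.1 x.2, sub_self])
    exact ⟨n, hn⟩
  let δ' : Ideal.span S →ₗ[A] N :=
    (LinearEquiv.ofInjective i hi).symm.toLinearMap ∘ₗ LinearMap.codRestrict _ δ hδ
  have hδ' : ∀ x, i (δ' x) = δ x := by
    intro x
    have := congrArg Subtype.val
      ((LinearEquiv.ofInjective i hi).apply_symm_apply (LinearMap.codRestrict _ δ hδ x))
    exact this
  obtain ⟨h, hh⟩ := hN S hS δ'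
  refine ⟨G - i ∘ₗ h, fun x hx => ?_, fun x hx => ?_⟩
  · have : p (i (h x)) = 0 := (hip _).2 ⟨_, rfl⟩
    simp [hG, hF x hx, this]
  · simp [hh x hx, hδ', δ]

theorem extends_succ (i : N →ₗ[A] E) (p : E →ₗ[A] C) (hi : Function.Injective i)
    (hp : Function.Surjective p) (hip : ∀ e, p e = 0 ↔ ∃ n, i n = e) (k : ℕ)
    (hE : Module.Baer A E)
    (hN : ExtendsBelow A k N) (hC : ExtendsBelow A k C) : ExtendsBelow A (k + 1) C := by
  intro S hS f
  have hS' : #S ≤ aleph k := by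
    have h : aleph ((k + 1 : ℕ) : Ordinal) = Order.succ (aleph (k : Ordinal)) := by
      rw [succ_aleph]; simp
    rw [h] at hS
    exact Order.lt_succ_iff.1 hS
  let J := (aleph.{u} k).ord.ToType
  have hJ : #J = aleph k := mk_ord_toType _
  obtain ⟨c⟩ : Nonempty (S ↪ J) := by
    rw [← hJ] at hS'; exact hS'
  let gen : Set J → Set A := fun T => {a | ∃ h : a ∈ S, c ⟨a, h⟩ ∈ T}
  have gen_mono : ∀ {T T' : Set J}, T ⊆ T' → gen T ⊆ gen T' := fun hT a ⟨h, h'⟩ => ⟨h, hT h'⟩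
  have gen_sub : ∀ T, gen T ⊆ S := fun T a ⟨h, _⟩ => h
  have gen_card : ∀ T, #(gen T) ≤ #T := by
    intro T
    refine mk_le_of_injective (f := fun a : gen T => (⟨c ⟨a.1, a.2.1⟩, a.2.2⟩ : T)) ?_
    intro a b hab
    have := c.injective (Subtype.ext_iff.1 hab)
    exact Subtype.ext (congrArg (fun s : S => s.1) this)
  -- Zorn
  let Z : Set (A →ₗ.[A] E) := {g | (∃ T : Set J, IsLowerSet T ∧ g.domain = Ideal.span (gen T)) ∧
    ∀ (x : A) (hx : x ∈ g.domain) (hx' : x ∈ Ideal.span S), p (g ⟨x, hx⟩) = f ⟨x, hx'⟩}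
  have hZ : ∃ m, Maximal (· ∈ Z) m := by
    refine zorn_le₀ Z ?_
    intro ch hch hchain
    have hdir : DirectedOn (· ≤ ·) ch := hchain.directedOn
    rcases ch.eq_empty_or_nonempty with rfl | hne
    · refine ⟨⊥, ⟨⟨∅, isLowerSet_empty, ?_⟩, ?_⟩, by simp⟩
      · have : gen ∅ = ∅ := by ext a; simp [gen]
        rw [this, Ideal.span_empty]; rfl
      · intro x hx hx'
        have h0 : x = 0 := (Submodule.mem_bot A).1 hx
        subst h0
        have h1 : (⟨0, hx⟩ : (⊥ : A →ₗ.[A] E).domain) = 0 := rfl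
        have h2 : (⟨0, hx'⟩ : Ideal.span S) = 0 := rfl
        rw [h1, h2]
        simp [LinearPMap.map_zero]
    refine ⟨LinearPMap.sSup ch hdir, ⟨?_, ?_⟩, fun g hg => LinearPMap.le_sSup hdir hg⟩
    · have : ∀ g : ch, ∃ T : Set J, IsLowerSet T ∧ g.1.domain = Ideal.span (gen T) :=
        fun g => (hch g.2).1
      choose T hT hT' using this
      refine ⟨⋃ g, T g, isLowerSet_iUnion hT, ?_⟩
      rw [LinearPMap.domain_sSup]
      apply le_antisymm
      · apply sSup_le
        rintro _ ⟨g, hg, rfl⟩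
        have := hT' ⟨g, hg⟩
        simp only at this
        rw [this]
        exact Ideal.span_mono (gen_mono (Set.subset_iUnion T ⟨g, hg⟩))
      · refine Ideal.span_le.2 ?_
        rintro a ⟨haS, ha⟩
        obtain ⟨g, hg⟩ := Set.mem_iUnion.1 ha
        have h1 : a ∈ g.1.domain := by
          rw [hT' g]; exact Ideal.subset_span ⟨haS, hg⟩
        exact (le_sSup (Set.mem_image_of_mem LinearPMap.domain g.2) :
          g.1.domain ≤ sSup (LinearPMap.domain '' ch)) h1
    · intro x hx hx'
      obtain ⟨g, hg, hxg⟩ := (LinearPMap.mem_domain_sSup_iff hne hdir).1 hx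
      have h1 : g ⟨x, hxg⟩ = LinearPMap.sSup ch hdir ⟨x, hx⟩ :=
        (LinearPMap.le_sSup hdir hg).2 rfl
      rw [← h1]
      exact (hch hg).2 x hxg hx'
  obtain ⟨g, hgZ, hmax⟩ := hZ
  obtain ⟨⟨T, hT, hgT⟩, hgf⟩ := hgZ
  have hdom : g.domain = Ideal.span S := by
    refine le_antisymm (hgT.trans_le (Ideal.span_mono (gen_sub T))) ?_
    by_contra hne
    have hne' : {b : J | ∃ s : S, c s = b ∧ s.1 ∉ g.domain}.Nonempty := by
      by_contra hemp
      apply hne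
      refine Ideal.span_le.2 fun s hs => ?_
      by_contra hsg
      exact hemp ⟨c ⟨s, hs⟩, ⟨s, hs⟩, rfl, hsg⟩
    obtain ⟨a, ⟨s, hsa, hsg⟩, hamin⟩ := WellFounded.has_min (wellFounded_lt (α := J)) _ hne'
    have hdom : g.domain = Ideal.span (gen (Set.Iio a)) := by
      apply le_antisymm
      · rw [hgT]
        refine Ideal.span_mono (gen_mono fun b hb => ?_)
        by_contra hba
        have haT : a ∈ T := hT (not_lt.1 hba) hb
        apply hsg
        rw [hgT]
        exact Ideal.subset_span ⟨s.2, by rw [← hsa] at haT; exact haT⟩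
      · refine Ideal.span_le.2 ?_
        rintro t ⟨htS, ht⟩
        by_contra htg
        exact hamin _ ⟨⟨t, htS⟩, rfl, htg⟩ ht
    have hcard : #(Set.Iio a) < aleph k := by
      have := mk_Iio_lt a (by rw [hJ]; simp [J])
      rwa [hJ] at this
    have hcard' : #(Set.Iic a) < aleph k := by
      have : Set.Iic a = insert a (Set.Iio a) := by
        rw [Set.Iio_insert]
      rw [this]
      refine lt_of_le_of_lt (mk_insert_le) ?_
      exact add_lt_of_lt (aleph0_le_aleph _) hcard
        (lt_of_lt_of_le one_lt_aleph0 (aleph0_le_aleph _))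
    have hsub : gen (Set.Iio a) ⊆ gen (Set.Iic a) := gen_mono Set.Iio_subset_Iic_self
    obtain ⟨g', hg'1, hg'2⟩ := lift_step i p hi hp hip k hN hC (gen (Set.Iio a)) (gen (Set.Iic a))
      ((gen_card _).trans_lt hcard) ((gen_card _).trans_lt hcard') hsub
      (f ∘ₗ Submodule.inclusion (Ideal.span_mono (gen_sub _)))
      (g.toFun ∘ₗ Submodule.inclusion hdom.ge)
      (by
        intro x hx
        exact hgf x (hdom.ge hx) (Ideal.span_mono (gen_sub _) hx))
    let G : A →ₗ.[A] E := ⟨Ideal.span (gen (Set.Iic a)), g' ∘ₗ Submodule.subtype _⟩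
    have hGZ : G ∈ Z := by
      refine ⟨⟨Set.Iic a, isLowerSet_Iic a, rfl⟩, ?_⟩
      intro x hx hx'
      exact hg'1 x hx
    have hle : g ≤ G := by
      refine ⟨by rw [hdom]; exact Ideal.span_mono hsub, ?_⟩
      rintro ⟨x, hx⟩ ⟨y, hy⟩ (rfl : x = y)
      exact (hg'2 x (hdom.le hx)).symm
    have hle' := (hmax hGZ hle).1
    exact hsg (hle' (Ideal.subset_span ⟨s.2, hsa.le⟩))
  obtain ⟨g', hg'⟩ := hE (Ideal.span S) (g.toFun ∘ₗ Submodule.inclusion hdom.ge)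
  refine ⟨p ∘ₗ g', fun x hx => ?_⟩
  rw [LinearMap.comp_apply, hg' x hx]
  exact hgf x (hdom.ge hx) hx

end step

section homological
open CategoryTheory.Abelian

variable {A : Type u} [CommRing A]

theorem hasPdLE_iff (d : ℕ) (M : ModuleCat.{u} A) : hasPdLE A d M ↔ HasProjectiveDimensionLE M d := by
  induction d generalizing M with
  | zero => exact projective_iff_hasProjectiveDimensionLE_zero (X := M)
  | succ d ih =>
    have key : ∀ (P : ModuleCat.{u} A) (f : P ⟶ M), Epi f → Projective P →
        (hasPdLE A d (kernel f) ↔ HasProjectiveDimensionLE M (d + 1)) := by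
      intro P f _ hP
      rw [ih]
      have hS : (ShortComplex.mk (kernel.ι f) f (kernel.condition f)).ShortExact :=
        { exact := ShortComplex.exact_kernel f }
      exact (hS.hasProjectiveDimensionLT_X₃_iff d hP).symm
    constructor
    · rintro ⟨P, f, hf, hP, h⟩
      exact (key P f hf hP).1 h
    · intro h
      exact ⟨Projective.over M, Projective.π M, inferInstance, inferInstance,
        (key _ _ inferInstance inferInstance).2 h⟩

/-- `C` is a `j`-th cosyzygy. -/
def Cosyz (A : Type u) [CommRing A] : ℕ → ModuleCat.{u} A → Prop
  | 0, _ => True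
  | j + 1, C => ∃ S : ShortComplex (ModuleCat.{u} A), S.ShortExact ∧ Injective S.X₂ ∧
      Cosyz A j S.X₁ ∧ S.X₃ = C

theorem Cosyz.pred {j : ℕ} {C : ModuleCat.{u} A} (h : Cosyz A (j + 1) C) : Cosyz A j C := by
  induction j generalizing C with
  | zero => trivial
  | succ j ih =>
    obtain ⟨S, hS, hI, h1, h2⟩ := h
    exact ⟨S, hS, hI, ih h1, h2⟩

theorem Cosyz.ext_eq_zero {d : ℕ} (X : ModuleCat.{u} A) (hX : HasProjectiveDimensionLE X d)
    (j : ℕ) (C : ModuleCat.{u} A) (hC : Cosyz A j C) (i : ℕ) (hi : 1 ≤ i) (hij : d + 1 ≤ i + j)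
    (e : Ext X C i) : e = 0 := by
  induction j generalizing C i with
  | zero => exact e.eq_zero_of_hasProjectiveDimensionLT (d + 1) hij
  | succ j ih =>
    obtain ⟨S, hS, hI, h1, rfl⟩ := hC
    obtain ⟨x, rfl⟩ := Ext.covariant_sequence_exact₃ X hS e rfl
      (ih S.X₁ h1 (i + 1) (by omega) (by omega) _)
    rw [x.eq_zero_of_hasInjectiveDimensionLT 1 hi]
    simp

theorem extends_of_ext (I : Ideal A) (C : ModuleCat.{u} A)
    (h : ∀ e : Ext (ModuleCat.of A (A ⧸ I)) C 1, e = 0) (g : I →ₗ[A] C) :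
    ∃ g' : A →ₗ[A] C, ∀ (x : A) (hx : x ∈ I), g' x = g ⟨x, hx⟩ := by
  let S : ShortComplex (ModuleCat.{u} A) := ShortComplex.mk (ModuleCat.ofHom I.subtype)
    (ModuleCat.ofHom I.mkQ) (by
      ext x
      exact (Submodule.Quotient.mk_eq_zero I).2 x.2)
  have hS : S.ShortExact :=
    { exact := by
        rw [ShortComplex.moduleCat_exact_iff]
        intro x hx
        exact ⟨⟨x, (Submodule.Quotient.mk_eq_zero I).1 hx⟩, rfl⟩
      mono_f := (ModuleCat.mono_iff_injective _).2 Subtype.val_injective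
      epi_g := (ModuleCat.epi_iff_surjective _).2 (Submodule.mkQ_surjective I) }
  obtain ⟨x, hx⟩ := Ext.contravariant_sequence_exact₁ hS C (Ext.mk₀ (ModuleCat.ofHom g)) rfl
    (h _)
  obtain ⟨φ, rfl⟩ := Ext.homEquiv₀.symm.surjective x
  rw [Ext.homEquiv₀_symm_apply, Ext.mk₀_comp_mk₀] at hx
  have hx' := Ext.homEquiv₀.symm.injective (a₁ := S.f ≫ φ) (a₂ := ModuleCat.ofHom g)
    (by simpa only [Ext.homEquiv₀_symm_apply] using hx)
  refine ⟨φ.hom, fun y hy => ?_⟩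
  exact congrArg (fun t => t.hom ⟨y, hy⟩) hx'

theorem cosyz_extends (d : ℕ)
    (hd : ∀ I : Ideal A, I.FG → HasProjectiveDimensionLE (ModuleCat.of A (A ⧸ I)) d) (k : ℕ)
    (C : ModuleCat.{u} A) (hC : Cosyz A (d + k) C) : ExtendsBelow A k C := by
  induction k generalizing C with
  | zero =>
    intro S hS g
    have hfin : S.Finite := by
      have := hS
      simp only [Nat.cast_zero, Cardinal.aleph_zero] at this
      exact Cardinal.lt_aleph0_iff_set_finite.1 this
    have hfg : (Ideal.span S).FG := ⟨hfin.toFinset, by simp⟩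
    exact extends_of_ext _ C
      (fun e => hC.ext_eq_zero _ (hd _ hfg) _ _ 1 le_rfl (by omega) e) g
  | succ k ih =>
    have hC' : ExtendsBelow A k C := ih C hC.pred
    obtain ⟨S, hS, hI, h1, rfl⟩ := hC
    have := hS.mono_f
    have := hS.epi_g
    have hE : Module.Baer A S.X₂ :=
      Module.Baer.of_injective (Module.injective_module_of_injective_object A S.X₂ (inj := hI))
    refine extends_succ S.f.hom S.g.hom ((ModuleCat.mono_iff_injective _).1 inferInstance)
      ((ModuleCat.epi_iff_surjective _).1 inferInstance) ?_ k hE (ih _ h1) hC'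
    intro e
    refine ⟨(ShortComplex.moduleCat_exact_iff S).1 hS.exact e, ?_⟩
    rintro ⟨n, rfl⟩
    simp

theorem injDim_of_cosyz (D : ℕ) (hD : ∀ C : ModuleCat.{u} A, Cosyz A D C → Injective C)
    (r : ℕ) : ∀ j, j + r = D → ∀ C : ModuleCat.{u} A, Cosyz A j C →
      HasInjectiveDimensionLT C (r + 1) := by
  induction r with
  | zero =>
    rintro j rfl C hC
    have := hD C hC
    infer_instance
  | succ r ih =>
    intro j hj C hC
    have hS : (ShortComplex.mk (Injective.ι C) (cokernel.π (Injective.ι C))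
      (cokernel.condition _)).ShortExact := { exact := ShortComplex.exact_cokernel _ }
    have hI : Injective (Injective.under C) := inferInstance
    exact (hS.hasInjectiveDimensionLT_X₃_iff r hI).1
      (ih (j + 1) (by omega) _ ⟨_, hS, hI, hC, rfl⟩)

theorem projDim_le_iff (M : Type u) [AddCommGroup M] [Module A M] (d : ℕ) :
    projDim A M ≤ d ↔ HasProjectiveDimensionLE (ModuleCat.of A M) d := by
  constructor
  · intro h
    have hne : {n : ℕ∞ | ∃ k : ℕ, n = k ∧ hasPdLE A k (ModuleCat.of A M)}.Nonempty := by
      by_contra hemp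
      rw [Set.not_nonempty_iff_eq_empty] at hemp
      unfold projDim at h
      rw [hemp, sInf_empty] at h
      exact absurd h (by simp)
    obtain ⟨k, hk, hk'⟩ := csInf_mem hne
    have hkd : k ≤ d := by
      have : (k : ℕ∞) ≤ d := hk ▸ h
      exact_mod_cast this
    have := (hasPdLE_iff k _).1 hk'
    exact hasProjectiveDimensionLT_of_ge _ (k + 1) (d + 1) (by omega)
  · intro h
    exact sInf_le ⟨d, rfl, (hasPdLE_iff d _).2 h⟩

end homological

/-- Let `A` be an `ℵ_n`-Noetherian ring for some integer `n ≥ -1`.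
Then `gldim A < ∞` if and only if
`sup{pd_A(A/a) : a a finitely generated ideal of A} < ∞`. -/
theorem stmt_7 (A : Type u) [CommRing A]
    (n : ℤ) (hn : -1 ≤ n) (hA : AlephNoetherian A n) :
    gldim A < ⊤ ↔ (⨆ I : {I : Ideal A // I.FG}, projDim A (A ⧸ I.1)) < ⊤ := by
  constructor
  · intro h
    refine lt_of_le_of_lt (iSup_le fun I => ?_) h
    exact le_iSup (fun M : ModuleCat.{u} A => projDim A M) (ModuleCat.of A (A ⧸ I.1))
  · intro h
    obtain ⟨d, hd⟩ := ENat.ne_top_iff_exists.1 h.ne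
    have hd' : ∀ I : Ideal A, I.FG → HasProjectiveDimensionLE (ModuleCat.of A (A ⧸ I)) d := by
      intro I hI
      rw [← projDim_le_iff, hd]
      exact le_iSup (fun I : {I : Ideal A // I.FG} => projDim A (A ⧸ I.1)) ⟨I, hI⟩
    let k := n.toNat + 1
    have hgen : ∀ I : Ideal A, ∃ S : Set A, I = Ideal.span S ∧
        Cardinal.mk S < Cardinal.aleph k := by
      intro I
      obtain ⟨S, hS, hc⟩ := hA I
      refine ⟨S, hS, ?_⟩
      split_ifs at hc with h0
      · refine lt_of_le_of_lt hc (Cardinal.aleph_lt_aleph.2 ?_)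
        exact_mod_cast Nat.lt_succ_self _
      · exact lt_of_lt_of_le (Cardinal.lt_aleph0_iff_set_finite.2 hc) (Cardinal.aleph0_le_aleph _)
    have hinj : ∀ C : ModuleCat.{u} A, Cosyz A (d + k) C → Injective C := by
      intro C hC
      have hB : Module.Baer A C := by
        intro I g
        obtain ⟨S, rfl, hc⟩ := hgen I
        exact cosyz_extends d hd' k C hC S hc g
      exact Module.injective_object_of_injective_module A C (inj := hB.injective)
    refine lt_of_le_of_lt (iSup_le fun M => ?_) (ENat.natCast_lt_top (d + k))
    rw [projDim_le_iff]
    refine (hasProjectiveDimensionLT_iff _ _).2 ?_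
    intro i hi Y e
    have := injDim_of_cosyz (d + k) hinj (d + k) 0 (by omega) Y trivial
    exact e.eq_zero_of_hasInjectiveDimensionLT (d + k + 1) hi
end

section
/- Let (R, m) be a quasi-local domain of prime characteristic p and let x_1, …, x_ℓ be nonzero nonunit elements of R^+. Then pd_{R^+}( R^+ / ((x_1^∞) + ⋯ + (x_ℓ^∞)) ) ≤ 2ℓ. -/
set_option synthInstance.maxHeartbeats 400000
set_option maxHeartbeats 1000000

universe u

open CategoryTheory CategoryTheory.Limits

namespace PdAux

lemma bridge (A : Type u) [CommRing A] (n : ℕ) :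
    ∀ M : ModuleCat.{u} A, HasProjectiveDimensionLT M (n + 1) → hasPdLE A n M := by
  induction n with
  | zero =>
    intro M h
    exact projective_iff_hasProjectiveDimensionLT_one.2 h
  | succ n ih =>
    intro M h
    refine ⟨Projective.over M, Projective.π M, inferInstance, inferInstance, ih _ ?_⟩
    have hS : (ShortComplex.mk (kernel.ι (Projective.π M)) (Projective.π M)
        (kernel.condition _)).ShortExact :=
      { exact := ShortComplex.exact_of_f_is_kernel _ (kernelIsKernel _)
        mono_f := by dsimp; infer_instance
        epi_g := by dsimp; infer_instance }
    exact (hS.hasProjectiveDimensionLT_X₃_iff n (by dsimp; infer_instance)).1 h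

section
variable {A : Type u} [CommRing A]
variable {M N P : Type u} [AddCommGroup M] [Module A M] [AddCommGroup N] [Module A N]
  [AddCommGroup P] [Module A P]

/-- projective dimension less than `n` for unbundled modules -/
abbrev LT (A : Type u) [CommRing A] (M : Type u) [AddCommGroup M] [Module A M] (n : ℕ) : Prop :=
  HasProjectiveDimensionLT (ModuleCat.of A M) n

lemma ses (f : M →ₗ[A] N) (g : N →ₗ[A] P) (hf : Function.Injective f)
    (hg : Function.Surjective g) (h : Function.Exact f g) :
    (ShortComplex.mk (ModuleCat.ofHom f) (ModuleCat.ofHom g)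
      (by ext x; exact h.apply_apply_eq_zero x)).ShortExact := by
  apply ModuleCat.shortComplex_shortExact
  · exact h
  · exact hf
  · exact hg

lemma finsupp_ses (f : M →ₗ[A] N) (g : N →ₗ[A] P) (hf : Function.Injective f)
    (hg : Function.Surjective g) (h : Function.Exact f g) :
    (ShortComplex.mk (ModuleCat.ofHom (Finsupp.mapRange.linearMap (α := ℕ) f))
      (ModuleCat.ofHom (Finsupp.mapRange.linearMap (α := ℕ) g))
      (by ext x; simp [h.apply_apply_eq_zero])).ShortExact := by
  refine ses _ _ ?_ ?_ ?_
  · exact Finsupp.mapRange_injective _ (map_zero f) hf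
  · exact Finsupp.mapRange_surjective _ (map_zero g) hg
  · rw [LinearMap.exact_iff, Finsupp.ker_mapRange, Finsupp.range_mapRange_linearMap]
    · rw [h.linearMap_ker_eq]
    · exact LinearMap.ker_eq_bot.2 hf

lemma finsupp_pd (n : ℕ) : ∀ (M : Type u) [AddCommGroup M] [Module A M],
    LT A M (n + 1) → LT A (ℕ →₀ M) (n + 1) := by
  induction n with
  | zero =>
    intro M _ _ h
    have h1 := projective_iff_hasProjectiveDimensionLT_one.2 h
    rw [← IsProjective.iff_projective] at h1
    refine projective_iff_hasProjectiveDimensionLT_one.1 ?_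
    rw [← IsProjective.iff_projective]
    classical
    exact Module.Projective.of_equiv (finsuppLequivDFinsupp (M := M) (ι := ℕ) A).symm
  | succ n ih =>
    intro M _ _ h
    let q : (M →₀ A) →ₗ[A] M := Finsupp.linearCombination A id
    have hq : Function.Surjective q := Finsupp.linearCombination_id_surjective A M
    have e1 := ses (M := LinearMap.ker q) (LinearMap.ker q).subtype q Subtype.val_injective hq
      (LinearMap.exact_subtype_ker_map q)
    have hk : LT A (LinearMap.ker q) (n + 1) :=
      (e1.hasProjectiveDimensionLT_X₃_iff n (by
        dsimp; rw [← IsProjective.iff_projective]; infer_instance)).1 h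
    have hk' := ih _ hk
    have e2 := finsupp_ses (M := LinearMap.ker q) (LinearMap.ker q).subtype q Subtype.val_injective hq
      (LinearMap.exact_subtype_ker_map q)
    exact (e2.hasProjectiveDimensionLT_X₃_iff n (by
        dsimp; rw [← IsProjective.iff_projective]; infer_instance)).2 hk'

/-- telescope map -/
noncomputable def psi (c : ℕ → A) : (ℕ →₀ M) →ₗ[A] (ℕ →₀ M) :=
  Finsupp.lsum A fun n => Finsupp.lsingle n - (c n) • Finsupp.lsingle (n + 1)

/-- augmentation -/
noncomputable def phi (g : ℕ → A) : (ℕ →₀ M) →ₗ[A] M :=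
  Finsupp.lsum A fun n => (g n) • LinearMap.id

lemma psi_single (c : ℕ → A) (n : ℕ) (m : M) :
    psi c (Finsupp.single n m) = Finsupp.single n m - Finsupp.single (n + 1) (c n • m) := by
  simp [psi]

lemma phi_single (g : ℕ → A) (n : ℕ) (m : M) :
    phi g (Finsupp.single n m) = g n • m := by
  simp [phi]

lemma psi_zero (c : ℕ → A) (z : ℕ →₀ M) : psi c z 0 = z 0 := by
  induction z using Finsupp.induction_linear with
  | zero => simp
  | add f g hf hg => simp [hf, hg]
  | single n m => simp [psi_single]

lemma psi_succ (c : ℕ → A) (z : ℕ →₀ M) (k : ℕ) :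
    psi c z (k + 1) = z (k + 1) - c k • z k := by
  induction z using Finsupp.induction_linear with
  | zero => simp
  | add f g hf hg => simp only [map_add, Finsupp.add_apply, hf, hg, smul_add]; abel
  | single n m =>
    rw [psi_single]
    by_cases h : n = k
    · subst h; simp
    · simp [Finsupp.single_apply, h]

lemma psi_inj (c : ℕ → A) : Function.Injective (psi (M := M) c) := by
  rw [injective_iff_map_eq_zero]
  intro z hz
  ext k
  induction k with
  | zero => rw [← psi_zero c, hz]
  | succ k ih =>
    have := psi_succ c z k
    rw [hz, ih] at this
    simpa using this.symm

lemma reduce (c : ℕ → A) (z : ℕ →₀ M) : ∃ N₀, ∀ N ≥ N₀, ∃ a : M,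
    z - Finsupp.single N a ∈ LinearMap.range (psi (M := M) c) := by
  induction z using Finsupp.induction_linear with
  | zero => exact ⟨0, fun N _ => ⟨0, by simp⟩⟩
  | add f g hf hg =>
    obtain ⟨N1, h1⟩ := hf
    obtain ⟨N2, h2⟩ := hg
    refine ⟨max N1 N2, fun N hN => ?_⟩
    obtain ⟨a, ha⟩ := h1 N (le_trans (le_max_left _ _) hN)
    obtain ⟨b, hb⟩ := h2 N (le_trans (le_max_right _ _) hN)
    refine ⟨a + b, ?_⟩
    have := Submodule.add_mem _ ha hb
    rw [Finsupp.single_add]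
    convert this using 1
    abel
  | single n m =>
    refine ⟨n, fun N hN => ?_⟩
    induction N, hN using Nat.le_induction with
    | base => exact ⟨m, by simp⟩
    | succ N hN ih =>
      obtain ⟨a, ha⟩ := ih
      refine ⟨c N • a, ?_⟩
      have := Submodule.add_mem _ ha (LinearMap.mem_range_self (psi c) (Finsupp.single N a))
      rw [psi_single] at this
      convert this using 1
      abel

lemma psi_phi_exact (g c : ℕ → A) (hgc : ∀ n, g n = c n * g (n + 1))
    (hM : ∀ n (m : M), g n • m = 0 → c n • m = 0) :
    Function.Exact (psi (M := M) c) (phi (M := M) g) := by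
  have hcomp : ∀ z, phi g (psi (M := M) c z) = 0 := by
    intro z
    induction z using Finsupp.induction_linear with
    | zero => simp
    | add f g hf hg => simp [hf, hg]
    | single n m =>
      rw [psi_single, map_sub, phi_single, phi_single, smul_smul, hgc n, mul_comm, sub_self]
  intro z
  constructor
  · intro hz
    obtain ⟨N, hN⟩ := reduce c z
    obtain ⟨a, w, hw⟩ := hN N le_rfl
    have h1 : g N • a = 0 := by
      have := hcomp w
      rw [hw, map_sub, hz, phi_single] at this
      simpa using this
    refine ⟨w + Finsupp.single N a, ?_⟩
    rw [map_add, hw, psi_single, hM N a h1]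
    simp
  · rintro ⟨w, rfl⟩
    exact hcomp w

lemma step (g c : ℕ → A) (hgc : ∀ n, g n = c n * g (n + 1))
    (hM : ∀ n (m : M), g n • m = 0 → c n • m = 0) (q : M →ₗ[A] N)
    (hq : Function.Surjective q) (hker : LinearMap.ker q = LinearMap.range (phi (M := M) g))
    (n : ℕ) (h : LT A M (n + 1)) : LT A N (n + 3) := by
  have hF := finsupp_pd n M h
  have e1 := ses (psi (M := M) c) (phi (M := M) g).rangeRestrict (psi_inj c)
    (LinearMap.surjective_rangeRestrict _) (by
      intro z
      rw [← psi_phi_exact g c hgc hM z, ← Submodule.coe_eq_zero]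
      rfl)
  have h1 : LT A (LinearMap.range (phi (M := M) g)) (n + 2) :=
    e1.hasProjectiveDimensionLT_X₃ (n + 1) hF
      (hasProjectiveDimensionLT_of_ge _ (n + 1) _ (by omega))
  have e2 := ses (LinearMap.range (phi (M := M) g)).subtype q Subtype.val_injective hq
    (by rw [← hker]; exact LinearMap.exact_subtype_ker_map q)
  exact e2.hasProjectiveDimensionLT_X₃ (n + 2) h1
      (hasProjectiveDimensionLT_of_ge _ (n + 1) _ (by omega))

end

section
variable {A : Type u} [CommRing A] (p : ℕ) [hp : Fact p.Prime] [CharP A p] [PerfectRing A p]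

/-- all `p`-power roots -/
def roots (x : A) : Set A := {y : A | ∃ n : ℕ, y ^ p ^ n = x}

lemma roots_eq (x : A) :
    roots p x = Set.range fun n : ℕ => ((frobeniusEquiv A p).symm^[n]) x := by
  ext y
  constructor
  · rintro ⟨n, hn⟩
    refine ⟨n, ?_⟩
    have h := iterate_frobeniusEquiv_symm_pow_p_pow A p x n
    rw [← hn, ← iterateFrobenius_def, ← iterateFrobenius_def] at h
    have := (bijective_iterateFrobenius A p n).1 h
    rw [← hn]
    simpa [iterateFrobenius_def] using this
  · rintro ⟨n, rfl⟩
    exact ⟨n, iterate_frobeniusEquiv_symm_pow_p_pow A p x n⟩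

lemma rad {ι : Type*} (x : ι → A) (a : A) (h : a ^ p ∈ Ideal.span (⋃ i, roots p (x i))) :
    a ∈ Ideal.span (⋃ i, roots p (x i)) := by
  have key : Ideal.span (⋃ i, roots p (x i)) ≤
      (Ideal.span (⋃ i, roots p (x i))).comap ((frobeniusEquiv A p).symm : A →+* A) := by
    rw [Ideal.span_le]
    intro y hy
    obtain ⟨i, n, hn⟩ := Set.mem_iUnion.1 hy
    refine Ideal.subset_span (Set.mem_iUnion.2 ⟨i, n + 1, ?_⟩)
    change ((frobeniusEquiv A p).symm y) ^ p ^ (n + 1) = x i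
    rw [pow_succ', pow_mul, frobeniusEquiv_symm_pow_p, hn]
  have := key h
  change (frobeniusEquiv A p).symm (a ^ p) ∈ Ideal.span (⋃ i, roots p (x i)) at this
  rwa [frobeniusEquiv_symm_pow] at this

lemma ideal_step (J : Ideal A) (hJ : ∀ a : A, a ^ p ∈ J → a ∈ J) (x : A) (n : ℕ)
    (h : LT A (A ⧸ J) (n + 1)) : LT A (A ⧸ (J ⊔ Ideal.span (roots p x))) (n + 3) := by
  have hp2 : 2 ≤ p := hp.out.two_le
  let g : ℕ → A := fun n => ((frobeniusEquiv A p).symm^[n]) x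
  have hg : ∀ n, g (n + 1) ^ p = g n := by
    intro n
    simp only [g, Function.iterate_succ_apply', frobeniusEquiv_symm_pow_p]
  refine step g (fun n => g (n + 1) ^ (p - 1)) ?_ ?_
    (Submodule.factor (le_sup_left : J ≤ J ⊔ Ideal.span (roots p x))) ?_ ?_ n h
  · intro n
    rw [← pow_succ, Nat.sub_add_cancel (by omega), hg]
  · intro n m hm
    obtain ⟨a, rfl⟩ := Ideal.Quotient.mk_surjective m
    change Ideal.Quotient.mk J (g n * a) = 0 at hm
    change Ideal.Quotient.mk J (g (n + 1) ^ (p - 1) * a) = 0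
    rw [Ideal.Quotient.eq_zero_iff_mem] at hm ⊢
    obtain ⟨b, rfl⟩ : ∃ b, b ^ p = a := ⟨_, frobeniusEquiv_symm_pow_p A p a⟩
    have h1 : g (n + 1) * b ∈ J := hJ _ (by rw [mul_pow, hg]; exact hm)
    obtain ⟨k, rfl⟩ : ∃ k, p = k + 2 := ⟨p - 2, by omega⟩
    have : g (n + 1) ^ (k + 2 - 1) * b ^ (k + 2)
        = (g (n + 1) ^ k * b ^ (k + 1)) * (g (n + 1) * b) := by
      rw [show k + 2 - 1 = k + 1 from rfl]; ring
    rw [this]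
    exact J.mul_mem_left _ h1
  · exact Submodule.factor_surjective _
  · apply le_antisymm
    · intro m hm
      obtain ⟨a, rfl⟩ := Ideal.Quotient.mk_surjective m
      have ha : a ∈ J ⊔ Ideal.span (roots p x) := by
        rw [← Ideal.Quotient.eq_zero_iff_mem]; exact hm
      obtain ⟨j, hj, i, hi, rfl⟩ := Submodule.mem_sup.1 ha
      rw [map_add, Ideal.Quotient.eq_zero_iff_mem.2 hj, zero_add]
      have : Ideal.span (roots p x) ≤
          (LinearMap.range (phi (M := A ⧸ J) g)).comap J.mkQ := by
        rw [roots_eq, Ideal.span, Submodule.span_le]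
        rintro _ ⟨k, rfl⟩
        refine ⟨Finsupp.single k (Ideal.Quotient.mk J 1), ?_⟩
        rw [phi_single]
        change Ideal.Quotient.mk J (g k * 1) = Ideal.Quotient.mk J (g k)
        rw [mul_one]
      exact this hi
    · rintro _ ⟨z, rfl⟩
      rw [LinearMap.mem_ker]
      induction z using Finsupp.induction_linear with
      | zero => simp
      | add f g hf hg => rw [map_add, map_add, hf, hg, add_zero]
      | single k m =>
        obtain ⟨a, rfl⟩ := Ideal.Quotient.mk_surjective m
        rw [phi_single]
        change Ideal.Quotient.mk _ (g k * a) = 0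
        rw [Ideal.Quotient.eq_zero_iff_mem]
        apply Ideal.mul_mem_right
        apply Ideal.mem_sup_right
        apply Ideal.subset_span
        rw [roots_eq]
        exact ⟨k, rfl⟩

lemma main (l : ℕ) : ∀ x : Fin l → A,
    LT A (A ⧸ Ideal.span (⋃ i, roots p (x i))) (2 * l + 1) := by
  induction l with
  | zero =>
    intro x
    have : Ideal.span (⋃ i, roots p (x i)) = ⊥ := by simp
    rw [this]
    refine projective_iff_hasProjectiveDimensionLT_one.1 ?_
    rw [← IsProjective.iff_projective]
    exact Module.Projective.of_equiv (Submodule.quotEquivOfEqBot (⊥ : Ideal A) rfl).symm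
  | succ l ih =>
    intro x
    have : Ideal.span (⋃ i, roots p (x i)) =
        Ideal.span (⋃ i : Fin l, roots p (x i.castSucc)) ⊔
          Ideal.span (roots p (x (Fin.last l))) := by
      rw [← Ideal.span_union]
      congr 1
      ext y
      simp only [Set.mem_iUnion, Set.mem_union]
      exact ⟨fun ⟨i, hi⟩ => by
        induction i using Fin.lastCases with
        | last => exact Or.inr hi
        | cast i => exact Or.inl ⟨i, hi⟩,
        fun h => h.elim (fun ⟨i, hi⟩ => ⟨_, hi⟩) (fun h => ⟨_, h⟩)⟩
    rw [this]
    exact ideal_step p _ (rad p _) _ _ (ih _)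

end

end PdAux

/-- Let `(R, m)` be a quasi-local domain of prime characteristic `p`
and let `x_1, …, x_ℓ` be nonzero nonunit elements of `R⁺`. Then
`pd_{R⁺}(R⁺ / ((x_1^∞) + ⋯ + (x_ℓ^∞))) ≤ 2ℓ`, where `(x^∞)` is the ideal of `R⁺`
generated by the (unique) `p^n`-th roots `x^{1/p^n}` of `x`, i.e. by
`{y : y ^ (p ^ n) = x for some n ≥ 0}`. -/
theorem stmt_10 (R : Type u) [CommRing R] [IsDomain R] [IsLocalRing R]
    (p : ℕ) (hp : p.Prime) [CharP R p]
    (ℓ : ℕ) (x : Fin ℓ → RPlus R) (hx0 : ∀ i, x i ≠ 0) (hxu : ∀ i, ¬IsUnit (x i)) :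
    projDim (RPlus R)
        (RPlus R ⧸ Ideal.span (⋃ i, {y : RPlus R | ∃ n : ℕ, y ^ p ^ n = x i}))
      ≤ ((2 * ℓ : ℕ) : ℕ∞) := by
  haveI : Fact p.Prime := ⟨hp⟩
  have hinj : Function.Injective (algebraMap R (AlgebraicClosure (FractionRing R))) := by
    rw [IsScalarTower.algebraMap_eq R (FractionRing R)]
    exact (algebraMap (FractionRing R) _).injective.comp (IsFractionRing.injective R _)
  have hinj' : Function.Injective (algebraMap R (RPlus R)) := by
    intro a b hab
    exact hinj (congrArg Subtype.val hab)
  haveI : CharP (RPlus R) p := charP_of_injective_algebraMap hinj' p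
  haveI : PerfectRing (RPlus R) p := by
    apply PerfectRing.ofSurjective
    intro y
    obtain ⟨z, hz⟩ := IsAlgClosed.exists_pow_nat_eq (y : AlgebraicClosure (FractionRing R)) hp.pos
    have hzi : IsIntegral R z := IsIntegral.of_pow hp.pos (by rw [hz]; exact y.2)
    exact ⟨⟨z, hzi⟩, Subtype.ext hz⟩
  exact sInf_le ⟨2 * ℓ, rfl, PdAux.bridge _ _ _ (PdAux.main p ℓ x)⟩
end

section
/- Let (R, m) be a one-dimensional Noetherian Henselian local domain whose residue field R/m has prime characteristic p. Then R^+ is ℵ_0-Noetherian, i.e., every ideal of R^+ can be generated by a countable set of elements. -/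
set_option synthInstance.maxHeartbeats 400000
set_option maxHeartbeats 1000000

universe u

section Helpers

open Polynomial IsLocalRing

theorem hens_section {R : Type u} [CommRing R] [HenselianLocalRing R]
    (R' : Type u) [CommRing R'] [Algebra R R'] [Algebra.Etale R R']
    (Q : Ideal R') [Q.IsPrime] [Q.LiesOver (maximalIdeal R)]
    (hbij : Function.Bijective (Ideal.ResidueField.mapₐ (maximalIdeal R) Q (Algebra.ofId _ _)
      (Ideal.over_def Q (maximalIdeal R)))) :
    Nonempty (R' →ₐ[R] R) := by
  obtain ⟨f, hfQ, hf⟩ := Algebra.IsEtaleAt.exists_isStandardEtale (R := R) Q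
  obtain ⟨P⟩ := hf.nonempty_standardEtalePresentation
  have hsurj : Function.Surjective (algebraMap R Q.ResidueField) := by
    have := hbij.surjective.comp (Ideal.algebraMap_residueField_surjective (maximalIdeal R))
    intro x
    obtain ⟨y, hy⟩ := this x
    refine ⟨y, ?_⟩
    rw [← hy]
    exact ((Ideal.ResidueField.mapₐ (maximalIdeal R) Q (Algebra.ofId _ _)
      (Ideal.over_def Q (maximalIdeal R))).commutes y).symm
  have hu : ∀ y : Submonoid.powers f, IsUnit (IsScalarTower.toAlgHom R R' Q.ResidueField y) := by
    rintro ⟨_, n, rfl⟩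
    simp only [map_pow]
    apply IsUnit.pow
    rw [isUnit_iff_ne_zero]
    simpa using hfQ
  let φ : Localization.Away f →ₐ[R] Q.ResidueField :=
    IsLocalization.liftAlgHom (M := Submonoid.powers f) (f := IsScalarTower.toAlgHom R R' Q.ResidueField) hu
  have hm := P.hasMap.map φ
  have h1 := hm.1
  have h2 := hm.isUnit_derivative_f.ne_zero
  have T := ((HenselianLocalRing.TFAE R).out 0 2).mp ‹_›
  obtain ⟨a, ha, haφ⟩ := T
    (algebraMap R Q.ResidueField) hsurj P.f P.monic_f (φ P.x) h1 h2
  have hma : P.HasMap a := by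
    refine ⟨by simpa [aeval_def] using ha, ?_⟩
    have h3 := hm.2
    rw [← haφ] at h3
    rw [aeval_algebraMap_apply] at h3
    by_contra hn
    have h4 : aeval a P.g ∈ maximalIdeal R := hn
    rw [Ideal.over_def Q (maximalIdeal R)] at h4
    apply h3.ne_zero
    rw [IsScalarTower.algebraMap_apply R R' Q.ResidueField]
    simpa using h4
  exact ⟨((P.lift a hma).comp P.equivRing.toAlgHom).comp (IsScalarTower.toAlgHom R R' (Localization.Away f))⟩

theorem hens_factor {R : Type u} [CommRing R] [HenselianLocalRing R] (p : R[X]) (hp : p.Monic)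
    (f g : (maximalIdeal R).ResidueField[X]) (hf : f.Monic) (hg : g.Monic)
    (H : p.map (algebraMap R _) = f * g) (Hpq : IsCoprime f g) :
    ∃ f' g' : R[X], f'.Monic ∧ g'.Monic ∧ p = f' * g' ∧ f'.natDegree = f.natDegree ∧
      g'.natDegree = g.natDegree := by
  obtain ⟨R', _, _, _, Q, _, _, f', g', hb, hf', hg', hpe, -, e1, e2⟩ :=
    Algebra.exists_etale_bijective_residueFieldMap_and_map_eq_mul_and_isCoprime
      (maximalIdeal R) p f g hp hf hg H Hpq
  obtain ⟨σ⟩ := hens_section R' Q hb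
  have : Nontrivial R' := σ.toRingHom.domain_nontrivial
  refine ⟨f'.map σ.toRingHom, g'.map σ.toRingHom, hf'.map _, hg'.map _, ?_, ?_, ?_⟩
  · rw [← Polynomial.map_mul, ← hpe, Polynomial.map_map]
    have : (σ.toRingHom.comp (algebraMap R R')) = RingHom.id R := by
      ext x; exact σ.commutes x
    rw [this, Polynomial.map_id]
  · rw [hf'.natDegree_map]
    have := congr(($e1).natDegree)
    rw [hf.natDegree_map, hf'.natDegree_map] at this
    exact this.symm
  · rw [hg'.natDegree_map]
    have := congr(($e2).natDegree)
    rw [hg.natDegree_map, hg'.natDegree_map] at this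
    exact this.symm

theorem isLocalRing_of_integral {R : Type u} [CommRing R] [HenselianLocalRing R]
    (A : Type*) [CommRing A] [IsDomain A] [Algebra R A] [Algebra.IsIntegral R A] :
    IsLocalRing A := by
  classical
  apply IsLocalRing.of_isUnit_or_isUnit_one_sub_self
  intro s
  have hex : ∃ n, ∃ p : R[X], p.Monic ∧ aeval s p = 0 ∧ p.natDegree = n := by
    obtain ⟨p, hp, hp0⟩ := Algebra.IsIntegral.isIntegral (R := R) s
    exact ⟨_, p, hp, hp0, rfl⟩
  obtain ⟨p, hp, hp0, hpn⟩ := Nat.find_spec hex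
  have hmin : ∀ q : R[X], q.Monic → aeval s q = 0 → p.natDegree ≤ q.natDegree := by
    intro q hq hq0
    rw [hpn]
    exact Nat.find_min' hex ⟨q, hq, hq0, rfl⟩
  set k := (maximalIdeal R).ResidueField
  set pb := p.map (algebraMap R k) with hpb
  have hpbm : pb.Monic := hp.map _
  obtain ⟨h, hh, hnd⟩ := Polynomial.exists_eq_pow_rootMultiplicity_mul_and_not_dvd pb hpbm.ne_zero 0
  set n := rootMultiplicity 0 pb
  simp only [map_zero, sub_zero] at hh hnd
  have hhm : h.Monic := (monic_X_pow n).of_mul_monic_left (by rw [← hh]; exact hpbm)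
  have hcop : IsCoprime ((X : k[X]) ^ n) h :=
    IsCoprime.pow_left ((Polynomial.irreducible_X.coprime_iff_not_dvd).2 hnd)
  obtain ⟨f', g', hf', hg', hpe, hfd, hgd⟩ := hens_factor p hp (X ^ n) h (monic_X_pow n) hhm hh hcop
  have hdeg : p.natDegree = n + h.natDegree := by
    rw [hpe, hf'.natDegree_mul hg', hfd, hgd, natDegree_X_pow]
  have hz : aeval s f' * aeval s g' = 0 := by rw [← map_mul, ← hpe, hp0]
  rcases mul_eq_zero.mp hz with hz | hz
  · right
    have h1 := hmin _ hf' hz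
    rw [hfd, natDegree_X_pow, hdeg] at h1
    have h2 : h = 1 := hhm.natDegree_eq_zero.mp (by omega)
    rw [h2, mul_one] at hh
    have hmem : ∀ M : Ideal A, M.IsMaximal → s ∈ M := by
      intro M hM
      have hMm : M.comap (algebraMap R A) = maximalIdeal R :=
        IsLocalRing.eq_maximalIdeal (Ideal.isMaximal_comap_of_isIntegral_of_isMaximal M)
      have hsn : s ^ n ∈ M := by
        have : aeval s (p - X ^ n) = - s ^ n := by simp [hp0]
        rw [← neg_mem_iff, ← this, aeval_eq_sum_range]
        refine sum_mem fun i _ => ?_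
        rw [Algebra.smul_def]
        refine M.mul_mem_right _ ?_
        rw [← Ideal.mem_comap, hMm, ← Ideal.algebraMap_residueField_eq_zero, ← coeff_map]
        rw [Polynomial.map_sub, ← hpb, hh]
        simp
      exact hM.isPrime.mem_of_pow_mem _ hsn
    by_contra hn
    obtain ⟨M, hM, hM2⟩ := exists_max_ideal_of_mem_nonunits hn
    exact hM.ne_top ((Ideal.eq_top_iff_one _).mpr (by simpa using add_mem hM2 (hmem M hM)))
  · left
    have h1 := hmin _ hg' hz
    rw [hgd, hdeg] at h1
    have h2 : n = 0 := by omega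
    rw [h2, pow_zero, one_mul] at hh
    have hu : IsUnit (p.coeff 0) := by
      by_contra hn
      have : p.coeff 0 ∈ maximalIdeal R := hn
      rw [← Ideal.algebraMap_residueField_eq_zero, ← coeff_map] at this
      apply hnd
      rw [X_dvd_iff, ← hh]
      exact this
    have h3 := congr(aeval s $(p.divX_mul_X_add))
    simp only [map_add, map_mul, aeval_X, aeval_C, hp0] at h3
    have h4 : s * aeval s p.divX = - algebraMap R A (p.coeff 0) := by
      rw [mul_comm]; exact eq_neg_of_add_eq_zero_left h3
    exact isUnit_of_mul_isUnit_left (h4 ▸ (hu.map (algebraMap R A)).neg)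


theorem unit_coeff_lemma {A L : Type*} [CommRing A] [IsLocalRing A] [Field L] [Algebra A L]
    (hA : ∀ y : L, IsIntegral A y → ∃ a, algebraMap A L a = y) (t : L) :
    ∀ (n : ℕ) (f : A[X]), f.natDegree ≤ n → aeval t f = 0 → (∃ i, IsUnit (f.coeff i)) →
      (∃ a, algebraMap A L a = t) ∨ (∃ a, algebraMap A L a = t⁻¹) := by
  intro n
  induction n with
  | zero =>
    rintro f hf h0 ⟨i, hi⟩
    exfalso
    rw [eq_C_of_natDegree_le_zero hf] at h0 hi
    rw [aeval_C] at h0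
    have hi0 : i = 0 := by
      by_contra hne
      rw [coeff_C, if_neg hne] at hi
      simpa using hi.map (algebraMap A L)
    rw [hi0, coeff_C_zero] at hi
    exact (hi.map (algebraMap A L)).ne_zero h0
  | succ n ih =>
    rintro f hf h0 ⟨i, hi⟩
    obtain ⟨s, hs⟩ : ∃ a, algebraMap A L a = f.coeff (n+1) • t := by
      rcases hf.lt_or_eq with hlt | heq
      · refine ⟨0, ?_⟩
        rw [coeff_eq_zero_of_natDegree_lt hlt]; simp
      · apply hA
        rw [← heq]
        exact isIntegral_leadingCoeff_smul f t h0
    have hin : i ≤ n + 1 := by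
      by_contra hlt
      rw [coeff_eq_zero_of_natDegree_lt (by omega)] at hi
      have := hi.map (algebraMap A L)
      simp at this
    let f' : A[X] := f - C (f.coeff (n+1)) * X ^ (n+1) + C s * X ^ n
    have hf'0 : aeval t f' = 0 := by
      simp only [f', map_add, map_sub, h0, map_mul, aeval_C, map_pow, aeval_X, hs, Algebra.smul_def]
      ring
    have hf'c : ∀ j, f'.coeff j = f.coeff j - (if j = n + 1 then f.coeff (n+1) else 0) + (if j = n then s else 0) := by
      intro j
      simp [f', coeff_X_pow]
    have hf'd : f'.natDegree ≤ n := by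
      rw [natDegree_le_iff_coeff_eq_zero]
      intro j hj
      rw [hf'c]
      by_cases h : j = n + 1
      · subst h; simp
      · have : f.coeff j = 0 := coeff_eq_zero_of_natDegree_lt (by omega)
        simp [h, this, (show j ≠ n by omega)]
    have hinv : ∀ u : A, IsUnit u → ∃ b, algebraMap A L b * algebraMap A L u = 1 := by
      intro u hu
      obtain ⟨b, hb⟩ := hu.exists_left_inv
      exact ⟨b, by rw [← map_mul, hb, map_one]⟩
    rcases hin.lt_or_eq with hlt | rfl
    · rcases (Nat.le_of_lt_succ hlt).lt_or_eq with hlt' | rfl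
      · exact ih f' hf'd hf'0 ⟨i, by rw [hf'c]; simpa [(show i ≠ n + 1 by omega), hlt'.ne] using hi⟩
      · have : IsUnit (f'.coeff i) ∨ IsUnit s := by
          have e : f.coeff i = f'.coeff i + (-s) := by rw [hf'c]; simp
          rw [e] at hi
          simpa using IsLocalRing.isUnit_or_isUnit_of_isUnit_add hi
        rcases this with h | h
        · exact ih f' hf'd hf'0 ⟨i, h⟩
        · right
          obtain ⟨b, hb⟩ := hinv s h
          refine ⟨b * f.coeff (i+1), ?_⟩
          apply eq_inv_of_mul_eq_one_left
          rw [map_mul, mul_assoc, ← Algebra.smul_def (f.coeff (i+1)) t, ← hs, hb]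
    · left
      obtain ⟨b, hb⟩ := hinv _ hi
      refine ⟨b * s, ?_⟩
      rw [map_mul, hs, Algebra.smul_def, ← mul_assoc, hb, one_mul]

theorem exists_unit_coeff {R : Type u} [CommRing R] [IsDomain R] [IsNoetherianRing R]
    [IsLocalRing R] (hdim : ringKrullDim R = 1) {L : Type*} [Field L] [Algebra R L]
    [FaithfulSMul R L] (t : L) (ht : IsAlgebraic R t) :
    ∃ f : R[X], aeval t f = 0 ∧ ∃ i, IsUnit (f.coeff i) := by
  by_contra! hcon
  have hd : ringKrullDim R[X] = 2 := by
    rw [Polynomial.ringKrullDim_of_isNoetherianRing, hdim]; rfl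
  have hm : maximalIdeal R ≠ ⊥ := by
    intro h
    have := (IsLocalRing.isField_iff_maximalIdeal_eq.mpr h)
    rw [ringKrullDim_eq_zero_of_isField this] at hdim
    exact zero_ne_one hdim
  obtain ⟨f0, hf0, hf0t⟩ := ht
  let P0 : PrimeSpectrum R[X] := ⟨⊥, Ideal.isPrime_bot⟩
  let P1 : PrimeSpectrum R[X] := ⟨RingHom.ker (aeval t : R[X] →ₐ[R] L), RingHom.ker_isPrime _⟩
  let P2 : PrimeSpectrum R[X] := ⟨(maximalIdeal R).map C, Ideal.isPrime_map_C_of_isPrime⟩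
  let P3 : PrimeSpectrum R[X] := ⟨(maximalIdeal R).comap constantCoeff, Ideal.comap_isPrime _ _⟩
  have h01 : P0 < P1 := by
    refine lt_of_le_of_ne (show (⊥ : Ideal R[X]) ≤ _ from bot_le) fun h => hf0 ?_
    have : f0 ∈ P1.asIdeal := hf0t
    rw [← h] at this
    exact this
  have h12 : P1 < P2 := by
    refine lt_of_le_of_ne ?_ ?_
    · intro f hf
      exact Ideal.mem_map_C_iff.mpr fun i => hcon f hf i
    · intro h
      obtain ⟨x, hx, hx0⟩ := Submodule.exists_mem_ne_zero_of_ne_bot hm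
      have : C x ∈ P2.asIdeal := Ideal.mem_map_of_mem _ hx
      rw [← h] at this
      have h2 : aeval t (C x) = 0 := this
      rw [aeval_C] at h2
      exact hx0 ((FaithfulSMul.algebraMap_injective R L) (by rw [h2, map_zero]))
  have h23 : P2 < P3 := by
    refine lt_of_le_of_ne ?_ ?_
    · intro f hf
      exact Ideal.mem_map_C_iff.mp hf 0
    · intro h
      have : (X : R[X]) ∈ P3.asIdeal := by simp [P3]
      rw [← h] at this
      have := Ideal.mem_map_C_iff.mp this 1
      simp at this
  let s : LTSeries (PrimeSpectrum R[X]) :=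
    (((RelSeries.singleton _ P0).snoc P1 (by simpa using h01)).snoc P2 (by simpa using h12)).snoc P3 (by simpa using h23)
  have hs := Order.LTSeries.length_le_krullDim s
  have hl : s.length = 3 := rfl
  rw [hl] at hs
  change _ ≤ ringKrullDim R[X] at hs
  rw [hd] at hs
  exact absurd hs (by decide)

theorem countable_values {R : Type u} [CommRing R] [IsDomain R] [IsNoetherianRing R]
    [IsLocalRing R] (hdim : ringKrullDim R = 1) {L : Type*} [Field L] [Algebra R L]
    [FaithfulSMul R L] {Γ : Type*} [LinearOrderedCommGroupWithZero Γ] (v : Valuation L Γ)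
    (hv : ∀ r : R, v (algebraMap R L r) ≤ 1) :
    (Set.range fun r : R => v (algebraMap R L r)).Countable := by
  have hm : maximalIdeal R ≠ ⊥ := by
    intro h
    have := (IsLocalRing.isField_iff_maximalIdeal_eq.mpr h)
    rw [ringKrullDim_eq_zero_of_isField this] at hdim
    exact zero_ne_one hdim
  obtain ⟨x, hx, hx0⟩ := Submodule.exists_mem_ne_zero_of_ne_bot hm
  have hK : Ring.KrullDimLE 1 R := by
    rw [Ring.krullDimLE_iff]; exact hdim.le
  have hpr : ∀ r : R, r ≠ 0 → ∀ P : Ideal R, P.IsPrime → r ∈ P → P = maximalIdeal R := by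
    intro r hr P hP hrP
    exact IsLocalRing.eq_maximalIdeal (hP.isMaximal_of_ne_bot (by rintro rfl; exact hr hrP))
  have hdvd : ∀ r : R, r ≠ 0 → ∃ n : ℕ, r ∣ x ^ n := by
    intro r hr
    have : x ∈ (Ideal.span {r}).radical := by
      rw [Ideal.radical_eq_sInf, Submodule.mem_sInf]
      rintro P ⟨hP1, hP⟩
      rw [hpr r hr P hP (hP1 (Ideal.mem_span_singleton_self r))]
      exact hx
    obtain ⟨n, hn⟩ := this
    exact ⟨n, Ideal.mem_span_singleton.mp hn⟩
  have hart : ∀ n : ℕ, IsArtinianRing (R ⧸ Ideal.span {x ^ n}) := by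
    intro n
    rw [isArtinianRing_iff_isNoetherianRing_krullDimLE_zero]
    refine ⟨inferInstance, Ring.KrullDimLE.mk₀ fun P hP => ?_⟩
    have h1 : (P.comap (Ideal.Quotient.mk (Ideal.span {x ^ n}))) = maximalIdeal R := by
      refine hpr (x ^ n) (pow_ne_zero _ hx0) _ inferInstance ?_
      rw [Ideal.mem_comap, Ideal.Quotient.eq_zero_iff_mem.mpr (Ideal.mem_span_singleton_self _)]
      exact zero_mem _
    have : (P.comap (Ideal.Quotient.mk (Ideal.span {x ^ n}))).IsMaximal := by rw [h1]; infer_instance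
    exact by
      have h2 := Ideal.IsMaximal.map_of_surjective_of_ker_le
        (f := Ideal.Quotient.mk (Ideal.span {x ^ n})) Ideal.Quotient.mk_surjective
        (m := P.comap (Ideal.Quotient.mk (Ideal.span {x ^ n})))
        (by rw [RingHom.ker_eq_comap_bot]; exact Ideal.comap_mono bot_le)
      rwa [Ideal.map_comap_of_surjective _ Ideal.Quotient.mk_surjective] at h2
  let J : Γ → Ideal R := fun γ =>
    { carrier := {r | v (algebraMap R L r) ≤ γ}
      add_mem' := by
        intro a b ha hb
        simp only [Set.mem_ofPred_eq, map_add] at *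
        exact v.map_add_le ha hb
      zero_mem' := by simp
      smul_mem' := by
        intro c r hr
        simp only [Set.mem_ofPred_eq, smul_eq_mul, map_mul] at *
        exact (mul_le_of_le_one_left' (hv c)).trans hr }
  have hJ : ∀ γ r, r ∈ J γ ↔ v (algebraMap R L r) ≤ γ := fun _ _ => Iff.rfl
  have hfin : ∀ n : ℕ, {γ : Γ | (∃ r : R, v (algebraMap R L r) = γ) ∧ v (algebraMap R L (x ^ n)) ≤ γ}.Finite := by
    intro n
    set T := {γ : Γ | (∃ r : R, v (algebraMap R L r) = γ) ∧ v (algebraMap R L (x ^ n)) ≤ γ}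
    have := hart n
    let q := Ideal.Quotient.mk (Ideal.span {x ^ n})
    have hq : Function.Surjective q := Ideal.Quotient.mk_surjective
    let F : T → Ideal (R ⧸ Ideal.span {x ^ n}) := fun γ => (J γ.1).map q
    have hcm : ∀ γ : T, ((J γ.1).map q).comap q = J γ.1 := by
      intro γ
      rw [Ideal.comap_map_of_surjective _ hq, ← RingHom.ker_eq_comap_bot, Ideal.mk_ker, sup_eq_left,
        Ideal.span_singleton_le_iff_mem]
      exact γ.2.2
    have hmono : StrictMono F := by
      intro a b hab
      refine lt_of_le_of_ne (Ideal.map_mono fun r hr => ?_) fun h => ?_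
      · exact le_trans ((hJ _ _).mp hr) hab.le
      · have h2 := hcm a
        change (F a).comap q = _ at h2
        rw [h] at h2
        have h3 := (hcm b).symm.trans h2
        obtain ⟨r, hr⟩ := b.2.1
        have : r ∈ J b.1 := hr.le
        rw [h3, hJ, hr] at this
        exact absurd this (not_le.mpr hab)
    have : WellFoundedLT T := hmono.wellFoundedLT
    have : WellFoundedGT T := hmono.wellFoundedGT
    exact Finite.of_wellFoundedLT_wellFoundedGT T
  refine Set.Countable.mono ?_ ((Set.countable_singleton (0:Γ)).union (Set.countable_iUnion fun n => (hfin n).countable))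
  rintro _ ⟨r, rfl⟩
  by_cases hr : r = 0
  · left; simp [hr]
  · right
    obtain ⟨n, c, hc⟩ := hdvd r hr
    refine Set.mem_iUnion.mpr ⟨n, ⟨r, rfl⟩, ?_⟩
    rw [hc, map_mul, map_mul]
    exact mul_le_of_le_one_right' (hv c)

theorem countable_values_alg {R : Type u} [CommRing R] {L : Type*} [Field L] [Algebra R L]
    [FaithfulSMul R L] {Γ : Type*} [LinearOrderedCommGroupWithZero Γ] (v : Valuation L Γ)
    (hc : (Set.range fun r : R => v (algebraMap R L r)).Countable)
    (halg : ∀ y : L, IsAlgebraic R y) : (Set.range v).Countable := by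
  set D := Set.range fun r : R => v (algebraMap R L r)
  have hcount : (⋃ n : ℕ, ⋃ a ∈ D, ⋃ b ∈ D, {γ : Γ | γ ^ (n+1) = a / b}).Countable := by
    refine Set.countable_iUnion fun n => hc.biUnion fun a _ => hc.biUnion fun b _ => ?_
    apply Set.Subsingleton.countable
    intro γ hγ δ hδ
    exact (pow_left_inj₀ zero_le zero_le (Nat.succ_ne_zero n)).mp (hγ.trans hδ.symm)
  refine hcount.mono ?_
  rintro _ ⟨y, rfl⟩
  simp only [Set.mem_iUnion, Set.mem_ofPred_eq]
  by_cases hy : y = 0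
  · exact ⟨0, _, ⟨0, rfl⟩, _, ⟨0, rfl⟩, by simp [hy]⟩
  obtain ⟨f, hf0, hf⟩ := halg y
  have hvy : v y ≠ 0 := (v.ne_zero_iff).mpr hy
  let g : ℕ → L := fun i => algebraMap R L (f.coeff i) * y ^ i
  have hg : ∀ i ∈ f.support, v (g i) ≠ 0 := by
    intro i hi
    rw [v.ne_zero_iff]
    refine mul_ne_zero ?_ (pow_ne_zero _ hy)
    rw [Ne, FaithfulSMul.algebraMap_eq_zero_iff]
    exact mem_support_iff.mp hi
  have hsum : ∑ i ∈ f.support, g i = 0 := by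
    rw [← hf, aeval_def, eval₂_eq_sum, Polynomial.sum]
  obtain ⟨i, hi, hmax⟩ := Finset.exists_max_image f.support (fun i => v (g i)) (support_nonempty.mpr hf0)
  have hj : ∃ j ∈ f.support, j ≠ i ∧ v (g j) = v (g i) := by
    by_contra! hn
    have := v.map_sum_eq_of_lt hi (f := g) (fun j hj => by
      simp only [Finset.mem_sdiff, Finset.mem_singleton] at hj
      exact lt_of_le_of_ne (hmax j hj.1) (hn j hj.1 hj.2))
    rw [hsum, map_zero] at this
    exact hg i hi this.symm
  obtain ⟨j, hj, hji, hjv⟩ := hj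
  have key : ∀ i j : ℕ, i ∈ f.support → j ∈ f.support → i < j → v (g j) = v (g i) →
      ∃ n, ∃ a ∈ D, ∃ b ∈ D, v y ^ (n+1) = a / b := by
    intro i j hi hj hij h
    obtain ⟨n, rfl⟩ := Nat.exists_eq_add_of_lt hij
    refine ⟨n, _, ⟨f.coeff i, rfl⟩, _, ⟨f.coeff (i + n + 1), rfl⟩, ?_⟩
    have hb : v (algebraMap R L (f.coeff (i + n + 1))) ≠ 0 := by
      rw [v.ne_zero_iff, Ne, FaithfulSMul.algebraMap_eq_zero_iff]
      exact mem_support_iff.mp hj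
    rw [eq_div_iff hb]
    simp only [g, map_mul, map_pow] at h
    rw [add_assoc, pow_add, mul_comm (v y ^ i), ← mul_assoc] at h
    rw [mul_comm]
    exact mul_right_cancel₀ (pow_ne_zero i hvy) h
  obtain ⟨n, a, ha, b, hb, h⟩ : ∃ n, ∃ a ∈ D, ∃ b ∈ D, v y ^ (n+1) = a / b := by
    rcases lt_or_gt_of_ne hji with hlt | hlt
    · exact key j i hj hi hlt hjv.symm
    · exact key i j hi hj hlt hjv
  exact ⟨n, a, ha, b, hb, h⟩

theorem ideal_countable {A L : Type*} [CommRing A] [IsDomain A] [ValuationRing A] [Field L]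
    [Algebra A L] [IsFractionRing A L]
    (hc : (Set.range (ValuationRing.valuation A L)).Countable) (I : Ideal A) :
    ∃ S : Set A, S.Countable ∧ I = Ideal.span S := by
  let w : A → ValuationRing.ValueGroup A L := fun a => ValuationRing.valuation A L (algebraMap A L a)
  have hT : (w '' (I : Set A)).Countable := hc.mono (by rintro _ ⟨a, _, rfl⟩; exact ⟨_, rfl⟩)
  have hch : ∀ γ : w '' (I : Set A), ∃ a ∈ I, w a = γ := fun γ => γ.2
  choose c hcI hcw using hch
  have := hT.to_subtype
  refine ⟨Set.range c, Set.countable_range c, le_antisymm ?_ (Ideal.span_le.mpr (by rintro _ ⟨γ, rfl⟩; exact hcI γ))⟩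
  intro y hy
  have h := hcw ⟨w y, y, hy, rfl⟩
  set s := c ⟨w y, y, hy, rfl⟩
  have hs : s ∈ Ideal.span (Set.range c) := Ideal.subset_span ⟨_, rfl⟩
  by_cases hs0 : s = 0
  · simp only [hs0, w, map_zero] at h
    have : y = 0 := by simpa using h.symm
    rw [this]; exact zero_mem _
  have hsL : algebraMap A L s ≠ 0 := by simpa using hs0
  have hle : ValuationRing.valuation A L (algebraMap A L y / algebraMap A L s) ≤ 1 := by
    rw [map_div₀]
    exact (div_le_one₀ (by rw [zero_lt_iff]; simpa using hs0)).mpr h.ge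
  obtain ⟨a, ha⟩ := (ValuationRing.mem_integer_iff A L _).mp hle
  have : y = a * s := by
    apply IsFractionRing.injective A L
    rw [map_mul, ha, div_mul_cancel₀ _ hsL]
  rw [this]
  exact Ideal.mul_mem_left _ _ hs

end Helpers

/-- Let `(R, m)` be a one-dimensional Noetherian Henselian local
domain whose residue field has prime characteristic `p`. Then `R⁺` is
`ℵ_0`-Noetherian: every ideal of `R⁺` is generated by a countable set. -/
theorem stmt_11 (R : Type u) [CommRing R] [IsDomain R] [IsNoetherianRing R]
    [HenselianLocalRing R] (hdim : ringKrullDim R = 1)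
    (p : ℕ) (hp : p.Prime) [CharP (IsLocalRing.ResidueField R) p]
    (I : Ideal (RPlus R)) :
    ∃ S : Set (RPlus R), S.Countable ∧ I = Ideal.span S := by
  have hinj : Function.Injective (algebraMap R (AlgebraicClosure (FractionRing R))) := by
    rw [IsScalarTower.algebraMap_eq R (FractionRing R) (AlgebraicClosure (FractionRing R))]
    rw [RingHom.coe_comp]
    exact (FaithfulSMul.algebraMap_injective (FractionRing R) (AlgebraicClosure (FractionRing R))).comp (IsFractionRing.injective R (FractionRing R))
  have hfaith : FaithfulSMul R (AlgebraicClosure (FractionRing R)) :=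
    (faithfulSMul_iff_algebraMap_injective _ _).mpr hinj
  have halg : Algebra.IsAlgebraic R (AlgebraicClosure (FractionRing R)) :=
    (IsFractionRing.comap_isAlgebraic_iff (K := FractionRing R)).mpr inferInstance
  have hloc : IsLocalRing (RPlus R) := isLocalRing_of_integral (R := R) (RPlus R)
  have hfrac : IsFractionRing (RPlus R) (AlgebraicClosure (FractionRing R)) :=
    integralClosure.isFractionRing_of_algebraic fun x hx => hinj (by rw [hx, map_zero])
  have hcl : ∀ y : AlgebraicClosure (FractionRing R), IsIntegral (RPlus R) y →
      ∃ a, algebraMap (RPlus R) (AlgebraicClosure (FractionRing R)) a = y := by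
    intro y hy
    exact ⟨⟨y, isIntegral_trans (R := R) y hy⟩, rfl⟩
  have hval : ValuationRing (RPlus R) := by
    rw [ValuationRing.iff_isInteger_or_isInteger (RPlus R) (K := AlgebraicClosure (FractionRing R))]
    intro t
    obtain ⟨f, hf, i, hi⟩ := exists_unit_coeff hdim t (halg.isAlgebraic t)
    refine unit_coeff_lemma hcl t _ (f.map (algebraMap R (RPlus R))) le_rfl ?_ ⟨i, ?_⟩
    · rw [Polynomial.aeval_map_algebraMap, hf]
    · rw [Polynomial.coeff_map]; exact hi.map _
  refine ideal_countable (L := AlgebraicClosure (FractionRing R)) ?_ I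
  refine countable_values_alg (R := R) _ (countable_values hdim _ fun r => ?_) halg.isAlgebraic
  rw [IsScalarTower.algebraMap_apply R (RPlus R) (AlgebraicClosure (FractionRing R))]
  exact (ValuationRing.mem_integer_iff _ _ _).mpr ⟨_, rfl⟩
end
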